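/- arXiv:1811.10186 — 10 statements merged into one kernel-verified Lean document; each statement's English description precedes it below -/
import Mathlib

section
/- Let M be a canonical Maya diagram, let k ≥ 1 be an integer, and let F be a finite set of nonnegative integers with |F| = p such that M Δ F = M ⊕ k. Then k and p have the same parity, 1 ≤ k ≤ p, and, writing p₋ = |F \ M| for the number of negative flips and p₊ = |F ∩ M| for the number of positive flips, one has p = p₋ + p₊ and k = p₋ − p₊. -/
/-- A Maya diagram in canonical form: it contains every negative integer,
does not contain `0`, and its nonnegative part is finite. -/
def IsCanonicalMaya (M : Set ℤ) : Prop :=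
  (∀ n : ℤ, n < 0 → n ∈ M) ∧ (0 : ℤ) ∉ M ∧ {n : ℤ | n ∈ M ∧ 0 ≤ n}.Finite

/-- The translate `M ⊕ k = {n + k : n ∈ M}`. -/
def mayaShift (M : Set ℤ) (k : ℤ) : Set ℤ := (fun n => n + k) '' M

/-- A finite set of nonnegative integers, viewed as a set of integers (the flip levels). -/
def finsetFlips (F : Finset ℕ) : Set ℤ := (fun n : ℕ => (n : ℤ)) '' ↑F

theorem finite_finsetFlips (F : Finset ℕ) : (finsetFlips F).Finite :=
  F.finite_toSet.image _

theorem ncard_finsetFlips (F : Finset ℕ) : (finsetFlips F).ncard = F.card := by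
  rw [finsetFlips, Set.ncard_image_of_injective _ Nat.cast_injective, Set.ncard_coe_finset]

theorem nonneg_of_mem_finsetFlips {F : Finset ℕ} {n : ℤ} (h : n ∈ finsetFlips F) : 0 ≤ n := by
  obtain ⟨m, -, rfl⟩ := h
  exact Int.natCast_nonneg m

theorem mem_mayaShift {M : Set ℤ} {k n : ℤ} : n ∈ mayaShift M k ↔ n - k ∈ M := by
  simp [mayaShift, ← sub_eq_add_neg]

/-- Shifting a canonical Maya diagram up by `k` adds `k` nonnegative elements. -/
theorem ncard_nonneg_mayaShift {M : Set ℤ} (hM : IsCanonicalMaya M) (k : ℕ) :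
    {n : ℤ | n ∈ mayaShift M k ∧ 0 ≤ n}.ncard = {n : ℤ | n ∈ M ∧ 0 ≤ n}.ncard + k := by
  obtain ⟨hneg, -, hfin⟩ := hM
  have hunion : {n : ℤ | n ∈ mayaShift M k ∧ 0 ≤ n} =
      (fun n : ℤ => n + k) '' {n : ℤ | n ∈ M ∧ 0 ≤ n} ∪ Finset.Ico (0 : ℤ) k := by
    ext n
    constructor
    · rintro ⟨hn, hn0⟩
      rw [mem_mayaShift] at hn
      by_cases h : n < k
      · exact Or.inr (by simp [h, hn0])
      · exact Or.inl ⟨n - k, ⟨hn, by omega⟩, by simp⟩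
    · rintro (⟨m, ⟨hm, hm0⟩, rfl⟩ | hn)
      · exact ⟨⟨m, hm, rfl⟩, by dsimp only; omega⟩
      · rw [Finset.mem_coe, Finset.mem_Ico] at hn
        exact ⟨mem_mayaShift.2 (hneg _ (by omega)), hn.1⟩
  have hdisj : Disjoint ((fun n : ℤ => n + k) '' {n : ℤ | n ∈ M ∧ 0 ≤ n})
      (Finset.Ico (0 : ℤ) k : Set ℤ) := by
    rw [Set.disjoint_left]
    rintro _ ⟨m, ⟨-, hm0⟩, rfl⟩ hn
    rw [Finset.mem_coe, Finset.mem_Ico] at hn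
    dsimp only at hn
    omega
  rw [hunion, Set.ncard_union_eq hdisj (hfin.image _) (Finset.finite_toSet _),
    Set.ncard_image_of_injective _ (add_left_injective (k : ℤ)), Set.ncard_coe_finset]
  simp

/-- Flipping `M` at the levels in `F` adds `F \ M` and removes `F ∩ M`. -/
theorem ncard_nonneg_symmDiff_finsetFlips {M : Set ℤ}
    (hfin : {n : ℤ | n ∈ M ∧ 0 ≤ n}.Finite) (F : Finset ℕ) :
    {n : ℤ | n ∈ symmDiff M (finsetFlips F) ∧ 0 ≤ n}.ncard + (finsetFlips F ∩ M).ncard =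
      {n : ℤ | n ∈ M ∧ 0 ≤ n}.ncard + (finsetFlips F \ M).ncard := by
  have hunion : {n : ℤ | n ∈ symmDiff M (finsetFlips F) ∧ 0 ≤ n} =
      ({n : ℤ | n ∈ M ∧ 0 ≤ n} \ finsetFlips F) ∪ (finsetFlips F \ M) := by
    ext n
    have := nonneg_of_mem_finsetFlips (F := F) (n := n)
    simp only [Set.mem_ofPred_eq, Set.mem_symmDiff, Set.mem_union, Set.mem_sdiff]
    tauto
  have hdisj : Disjoint ({n : ℤ | n ∈ M ∧ 0 ≤ n} \ finsetFlips F) (finsetFlips F \ M) :=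
    Set.disjoint_left.2 fun _ h h' => h.2 h'.1
  have hinter : {n : ℤ | n ∈ M ∧ 0 ≤ n} ∩ finsetFlips F = finsetFlips F ∩ M := by
    ext n
    have := nonneg_of_mem_finsetFlips (F := F) (n := n)
    simp only [Set.mem_ofPred_eq, Set.mem_inter_iff]
    tauto
  have hsplit := Set.ncard_inter_add_ncard_sdiff_eq_ncard _ (finsetFlips F) hfin
  rw [hinter] at hsplit
  rw [hunion, Set.ncard_union_eq hdisj hfin.sdiff (finite_finsetFlips F).sdiff]
  omega

/-- if a canonical Maya diagram `M` is sent to `M ⊕ k` (`k ≥ 1`) by the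
`p` flips of a finite set `F` of nonnegative integers, then `k` and `p` have the same
parity, `1 ≤ k ≤ p`, and with `p₋ = |F \ M|` (negative flips) and `p₊ = |F ∩ M|`
(positive flips) one has `p = p₋ + p₊` and `k = p₋ - p₊`. -/
theorem cyclic_maya_parity (M : Set ℤ) (hM : IsCanonicalMaya M) (k p : ℕ) (hk : 1 ≤ k)
    (F : Finset ℕ) (hcard : F.card = p)
    (hcyc : symmDiff M (finsetFlips F) = mayaShift M (k : ℤ)) :
    p % 2 = k % 2 ∧ 1 ≤ k ∧ k ≤ p ∧
    p = (finsetFlips F \ M).ncard + (finsetFlips F ∩ M).ncard ∧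
    (k : ℤ) = ((finsetFlips F \ M).ncard : ℤ) - ((finsetFlips F ∩ M).ncard : ℤ) := by
  have hsplit := Set.ncard_inter_add_ncard_sdiff_eq_ncard _ M (finite_finsetFlips F)
  rw [ncard_finsetFlips] at hsplit
  have hflip := ncard_nonneg_symmDiff_finsetFlips hM.2.2 F
  rw [hcyc, ncard_nonneg_mayaShift hM] at hflip
  omega
end

section
/- Let M be a canonical Maya diagram, let k ≥ 1 be an integer, and let F be a finite set of nonnegative integers such that M Δ F = M ⊕ k. Then for every residue class l ∈ {0, 1, …, k−1}, the number of elements of F congruent to l modulo k is odd; in particular |F| ≥ k. -/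
theorem mem_finsetFlips_natCast {F : Finset ℕ} {ν : ℕ} : (ν : ℤ) ∈ finsetFlips F ↔ ν ∈ F := by
  simp [finsetFlips]

/-- Along a residue class, the parity of the number of flips below a given level records
whether the preceding level is empty. -/
theorem odd_card_flips_below_iff {M : Set ℤ} {k l : ℕ} {F : Finset ℕ}
    (hneg : ∀ n : ℤ, n < 0 → n ∈ M) (hl : l < k)
    (hcyc : symmDiff M (finsetFlips F) = mayaShift M (k : ℤ)) (j : ℕ) :
    Odd ((Finset.range j).filter (fun i => l + i * k ∈ F)).card ↔
      ((l + j * k : ℕ) : ℤ) - k ∉ M := by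
  induction j with
  | zero =>
    have h : ((l + 0 * k : ℕ) : ℤ) - k ∈ M := hneg _ (by push_cast; omega)
    simpa using h
  | succ j ih =>
    have hstep : ((l + (j + 1) * k : ℕ) : ℤ) - k = ((l + j * k : ℕ) : ℤ) := by
      push_cast
      ring
    have hflip : ((l + j * k : ℕ) : ℤ) ∈ symmDiff M (finsetFlips F) ↔
        ((l + j * k : ℕ) : ℤ) - k ∈ M := by
      rw [hcyc, mem_mayaShift]
    rw [Set.mem_symmDiff, mem_finsetFlips_natCast] at hflip
    rw [hstep, Finset.range_add_one, Finset.filter_insert]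
    split_ifs with hF
    · rw [Finset.card_insert_of_notMem (by simp), Nat.odd_add_one, ih]
      tauto
    · rw [ih]
      tauto

theorem odd_card_flips_in_residue_class {M : Set ℤ} (hM : IsCanonicalMaya M) {k l : ℕ}
    {F : Finset ℕ} (hl : l < k)
    (hcyc : symmDiff M (finsetFlips F) = mayaShift M (k : ℤ)) :
    Odd (F.filter (fun ν => ν % k = l)).card := by
  have hk : 0 < k := by omega
  obtain ⟨hneg, -, hfin⟩ := hM
  obtain ⟨B, hB⟩ := hfin.bddAbove
  obtain ⟨j, hjB, hjF⟩ : ∃ j : ℕ, B.toNat + 1 < j ∧ ∀ ν ∈ F, ν < j :=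
    ⟨B.toNat + 2 + F.sup id, by omega, fun ν hν => by
      have := Finset.le_sup (f := id) hν
      simp only [id] at this
      omega⟩
  have himage : F.filter (fun ν => ν % k = l) =
      ((Finset.range j).filter (fun i => l + i * k ∈ F)).image (fun i => l + i * k) := by
    ext ν
    simp only [Finset.mem_filter, Finset.mem_image, Finset.mem_range]
    constructor
    · rintro ⟨hν, rfl⟩
      have h : ν % k + ν / k * k = ν := by rw [mul_comm]; exact Nat.mod_add_div ν k
      exact ⟨ν / k, ⟨(Nat.div_le_self ν k).trans_lt (hjF ν hν), by rwa [h]⟩, h⟩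
    · rintro ⟨i, ⟨-, hi⟩, rfl⟩
      exact ⟨hi, by rw [Nat.add_mul_mod_self_right, Nat.mod_eq_of_lt hl]⟩
  rw [himage, Finset.card_image_of_injective _
    (fun a b h => Nat.eq_of_mul_eq_mul_right hk (Nat.add_left_cancel h)),
    odd_card_flips_below_iff hneg hl hcyc]
  intro hmem
  obtain ⟨i, rfl⟩ : ∃ i, j = i + 1 := ⟨j - 1, by omega⟩
  have hik : i ≤ i * k := Nat.le_mul_of_pos_right i hk
  have heq : ((l + (i + 1) * k : ℕ) : ℤ) - k = ((l + i * k : ℕ) : ℤ) := by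
    push_cast
    ring
  rw [heq] at hmem
  have := hB ⟨hmem, Int.natCast_nonneg _⟩
  omega

/-- if a canonical Maya diagram `M` satisfies `M Δ F = M ⊕ k` for a finite
set `F` of nonnegative integers and `k ≥ 1`, then for every residue class
`l ∈ {0, …, k-1}` the number of elements of `F` congruent to `l` modulo `k` is odd;
in particular `|F| ≥ k`. -/
theorem cyclic_maya_odd_in_each_support (M : Set ℤ) (hM : IsCanonicalMaya M)
    (k : ℕ) (hk : 1 ≤ k) (F : Finset ℕ)
    (hcyc : symmDiff M (finsetFlips F) = mayaShift M (k : ℤ)) :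
    (∀ l : ℕ, l < k → Odd (F.filter (fun ν => ν % k = l)).card) ∧ k ≤ F.card := by
  have hodd : ∀ l : ℕ, l < k → Odd (F.filter (fun ν => ν % k = l)).card :=
    fun l hl => odd_card_flips_in_residue_class hM hl hcyc
  refine ⟨hodd, ?_⟩
  have hsub : Finset.range k ⊆ F.image (fun ν => ν % k) := by
    intro l hl
    obtain ⟨ν, hν⟩ := Finset.card_pos.mp (hodd l (Finset.mem_range.mp hl)).pos
    rw [Finset.mem_filter] at hν
    exact Finset.mem_image.mpr ⟨ν, hν⟩
  simpa using (Finset.card_le_card hsub).trans Finset.card_image_le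
end

section
/- Structure of p-cyclic Maya diagrams (forward direction): let M be a canonical Maya diagram with positive part M₊, let k ≥ 1, and let F be a finite set of nonnegative integers with |F| = p such that M Δ F = M ⊕ k. Then p − k = 2j for some integer j ≥ 0, and there exist natural numbers α₁, …, α_{k−1} ≥ 0 and positive integers λ₁, …, λ_j, μ₁, …, μ_j ≥ 1 such that M₊ is the disjoint union of the Okamoto blocks (l | α_l)_k for l = 1, …, k−1 and the second-type blocks (λ_i | μ_i)_k for i = 1, …, j, and moreover F = {0} ∪ {l + α_l·k : 1 ≤ l ≤ k−1} ∪ {λ_i : 1 ≤ i ≤ j} ∪ {λ_i + μ_i·k : 1 ≤ i ≤ j}, these p listed elements being pairwise distinct. -/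
open Function

/-- The positive part of a canonical Maya diagram, as a set of naturals. -/
def mayaPos (M : Set ℤ) : Set ℕ := {n : ℕ | (n : ℤ) ∈ M}

/-- The block `(r | s)_k = {r, r + k, …, r + (s-1)k}`. -/
def kBlock (r s k : ℕ) : Set ℕ := {n : ℕ | ∃ i < s, n = r + i * k}

/-- The flip levels of a cyclic canonical Maya diagram are the naturals at which membership
changes along a `k`-step. -/
theorem mem_flips_iff {M : Set ℤ} (hM : IsCanonicalMaya M) {k : ℕ} {F : Finset ℕ}
    (hcyc : symmDiff M (finsetFlips F) = mayaShift M (k : ℤ)) (n : ℕ) :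
    n ∈ F ↔ ¬ (n ∈ mayaPos M ↔ (n < k ∨ n - k ∈ mayaPos M)) := by
  have hn := Set.ext_iff.mp hcyc (n : ℤ)
  have hflip : (n : ℤ) ∈ finsetFlips F ↔ n ∈ F := by simp [finsetFlips]
  have hshift : (n : ℤ) ∈ mayaShift M k ↔ (n < k ∨ n - k ∈ mayaPos M) := by
    have hsub : (n : ℤ) ∈ mayaShift M k ↔ (n : ℤ) - k ∈ M := by
      simp [mayaShift, ← sub_eq_add_neg]
    rw [hsub]
    rcases lt_or_ge n k with h | h
    · exact iff_of_true (hM.1 _ (by omega)) (Or.inl h)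
    · simp [mayaPos, Nat.cast_sub h, Nat.not_lt.mpr h]
  rw [Set.mem_symmDiff, hflip, hshift] at hn
  change (n ∈ mayaPos M ∧ _ ∨ _ ∧ ¬ n ∈ mayaPos M) ↔ _ at hn
  tauto

theorem mayaPos_finite {M : Set ℤ} (hM : IsCanonicalMaya M) : (mayaPos M).Finite :=
  (hM.2.2.preimage (Nat.cast_injective (R := ℤ)).injOn).subset
    fun n hn => ⟨hn, Int.natCast_nonneg n⟩

section Runs

variable {A : Set ℕ} {k : ℕ}

/-- In a finite set, every `k`-progression has a first point of exit. -/
theorem exists_run_length (hA : A.Finite) (hk : 1 ≤ k) (n : ℕ) :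
    ∃ m, n + m * k ∉ A ∧ ∀ i < m, n + i * k ∈ A := by
  classical
  have hex : ∃ m, n + m * k ∉ A := by
    obtain ⟨b, hb⟩ := hA.bddAbove
    refine ⟨b + 1, fun h => ?_⟩
    have := hb h
    nlinarith
  exact ⟨Nat.find hex, Nat.find_spec hex, fun i hi => not_not.mp (Nat.find_min hex hi)⟩

/-- `n` starts a `k`-run of `A` (possibly an empty one when `n < k`). -/
def IsRunStart (A : Set ℕ) (k n : ℕ) : Prop := n < k ∨ (n ∈ A ∧ n - k ∉ A)

variable {len : ℕ → ℕ}

/-- Runs, including their exit points, determine their starting points. -/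
theorem IsRunStart.eq_of_add_mul_eq (hlen : ∀ n, ∀ i < len n, n + i * k ∈ A)
    {s t i j : ℕ} (hs : IsRunStart A k s) (ht : IsRunStart A k t)
    (hi : i ≤ len s) (hj : j ≤ len t) (h : s + i * k = t + j * k) : s = t := by
  wlog hij : i ≤ j generalizing s t i j
  · exact (this ht hs hj hi h.symm (le_of_not_ge hij)).symm
  obtain ⟨d, rfl⟩ := Nat.exists_eq_add_of_le hij
  have hst : s = t + d * k := by rw [add_mul] at h; omega
  rcases d with _ | d
  · simpa using hst
  · rw [add_mul, one_mul] at hst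
    rcases hs with hs | ⟨-, hs⟩
    · omega
    · exact absurd (hlen t d (by omega)) (by rwa [show t + d * k = s - k by omega])

/-- Every element of `A` belongs to a run. -/
theorem exists_run_of_mem (hk : 1 ≤ k) (hend : ∀ n, n + len n * k ∉ A) (n : ℕ) (hn : n ∈ A) :
    ∃ s, IsRunStart A k s ∧ ∃ i < len s, n = s + i * k := by
  induction n using Nat.strong_induction_on with
  | _ n ih =>
    by_cases hs : IsRunStart A k n
    · refine ⟨n, hs, 0, Nat.pos_of_ne_zero fun h0 => hend n ?_, by simp⟩
      simpa [h0] using hn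
    · simp only [IsRunStart, not_or, not_and, not_not] at hs
      obtain ⟨s, hs', i, hi, e⟩ := ih (n - k) (by omega) (hs.2 hn)
      have e' : n = s + (i + 1) * k := by rw [add_mul, one_mul]; omega
      refine ⟨s, hs', i + 1, lt_of_le_of_ne hi fun h => hend s ?_, e'⟩
      rwa [← h, ← e']

/-- The points outside `A` preceded by `A` (or by a negative integer) are the exit points of
the runs. -/
theorem run_exit_iff (hk : 1 ≤ k) (hend : ∀ n, n + len n * k ∉ A)
    (hlen : ∀ n, ∀ i < len n, n + i * k ∈ A) (n : ℕ) :
    (n ∉ A ∧ (n < k ∨ n - k ∈ A)) ↔ ∃ s, IsRunStart A k s ∧ n = s + len s * k := by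
  constructor
  · rintro ⟨hn, h⟩
    by_cases hnk : n < k
    · refine ⟨n, Or.inl hnk, ?_⟩
      rcases Nat.eq_zero_or_pos (len n) with h0 | h0
      · simp [h0]
      · exact absurd (by simpa using hlen n 0 h0) hn
    · obtain ⟨s, hs, i, hi, e⟩ := exists_run_of_mem hk hend _ (h.resolve_left hnk)
      have e' : n = s + (i + 1) * k := by rw [add_mul, one_mul]; omega
      rcases (Nat.succ_le_of_lt hi).lt_or_eq with h1 | h1
      · exact absurd (e' ▸ hlen s _ h1) hn
      · exact ⟨s, hs, by rw [← h1]; exact e'⟩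
  · rintro ⟨s, hs, rfl⟩
    refine ⟨hend s, ?_⟩
    rcases h : len s with _ | m
    · rcases hs with hs | ⟨hs, -⟩
      · left; simpa using hs
      · exact absurd (by simpa [h] using hs) (hend s)
    · right
      have := hlen s m (by omega)
      rwa [show s + (m + 1) * k - k = s + m * k by rw [add_mul, one_mul]; omega]

end Runs

/-- structure of p-cyclic Maya diagrams, forward direction:
if a canonical Maya diagram `M` is sent to `M ⊕ k` (`k ≥ 1`) by the `p` flips of a
finite set `F` of nonnegative integers, then `p = k + 2j` for some `j ≥ 0`, the
positive part of `M` is the disjoint union of `k-1` Okamoto blocks `(l | αₗ)_k` and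
`j` second-type blocks `(λᵢ | μᵢ)_k`, and `F` consists exactly of `0`, the elements
`l + αₗ·k`, the elements `λᵢ` and the elements `λᵢ + μᵢ·k`. -/
theorem cyclic_maya_structure (M : Set ℤ) (hM : IsCanonicalMaya M) (k p : ℕ) (hk : 1 ≤ k)
    (F : Finset ℕ) (hcard : F.card = p)
    (hcyc : symmDiff M (finsetFlips F) = mayaShift M (k : ℤ)) :
    ∃ j : ℕ, p = k + 2 * j ∧
      ∃ (α : Fin (k - 1) → ℕ) (lam mu : Fin j → ℕ),
        (∀ i, 1 ≤ lam i) ∧ (∀ i, 1 ≤ mu i) ∧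
        Pairwise (Disjoint on (Sum.elim
          (fun l : Fin (k - 1) => kBlock (l.val + 1) (α l) k)
          (fun i : Fin j => kBlock (lam i) (mu i) k))) ∧
        mayaPos M = (⋃ l : Fin (k - 1), kBlock (l.val + 1) (α l) k) ∪
          (⋃ i : Fin j, kBlock (lam i) (mu i) k) ∧
        (↑F : Set ℕ) = {0} ∪ {n : ℕ | ∃ l : Fin (k - 1), n = (l.val + 1) + α l * k}
          ∪ {n : ℕ | ∃ i : Fin j, n = lam i}
          ∪ {n : ℕ | ∃ i : Fin j, n = lam i + mu i * k} := by
  classical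
  have hflip := mem_flips_iff hM hcyc
  have h0 : 0 ∉ mayaPos M := fun h => hM.2.1 (by simpa [mayaPos] using h)
  choose len hend hlen using exists_run_length (mayaPos_finite hM) hk
  generalize mayaPos M = A at *
  set U : Finset ℕ := F.filter (· ∈ A) with hU
  have hUmem : ∀ n, n ∈ U ↔ k ≤ n ∧ n ∈ A ∧ n - k ∉ A := by
    intro n
    rw [hU, Finset.mem_filter, hflip, ← not_lt]
    tauto
  have hstart : ∀ n, IsRunStart A k n ↔ n ∈ Finset.range k ∪ U := by
    intro n
    rw [Finset.mem_union, Finset.mem_range, hUmem, IsRunStart, ← not_lt]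
    tauto
  have hF : F = U ∪ (Finset.range k ∪ U).image fun s => s + len s * k := by
    ext n
    have hexit := run_exit_iff hk hend hlen n
    simp only [hstart] at hexit
    rw [Finset.mem_union, Finset.mem_image, hUmem, hflip, ← not_lt]
    simp only [eq_comm (b := n)]
    rw [← hexit]
    tauto
  have hlen0 : len 0 = 0 := by
    by_contra h
    exact h0 (by simpa using hlen 0 0 (Nat.pos_of_ne_zero h))
  have hpos : ∀ u ∈ U, 1 ≤ len u := fun u hu => Nat.pos_of_ne_zero fun h =>
    hend u (by simpa [h] using ((hUmem u).mp hu).2.1)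
  have hcardF : F.card = k + 2 * U.card := by
    have hdisj : Disjoint U ((Finset.range k ∪ U).image fun s => s + len s * k) := by
      rw [Finset.disjoint_left]
      intro n hn hn'
      obtain ⟨s, -, rfl⟩ := Finset.mem_image.mp hn'
      exact hend s ((hUmem _).mp hn).2.1
    have hdisj' : Disjoint (Finset.range k) U := by
      rw [Finset.disjoint_left]
      intro n hn hn'
      exact absurd (Finset.mem_range.mp hn) (not_lt.mpr ((hUmem n).mp hn').1)
    have hinj : Set.InjOn (fun s => s + len s * k) (Finset.range k ∪ U : Finset ℕ) :=
      fun s hs t ht h => ((hstart s).mpr hs).eq_of_add_mul_eq hlen ((hstart t).mpr ht)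
        le_rfl le_rfl h
    have hcardU := Finset.card_union_of_disjoint hdisj
    rw [← hF, Finset.card_image_of_injOn hinj, Finset.card_union_of_disjoint hdisj',
      Finset.card_range] at hcardU
    omega
  let lam : Fin U.card → ℕ := fun i => U.equivFin.symm i
  have hlam : ∀ i, lam i ∈ U := fun i => (U.equivFin.symm i).2
  have hlamsurj : ∀ u ∈ U, ∃ i, u = lam i := fun u hu => ⟨U.equivFin ⟨u, hu⟩, by simp [lam]⟩
  have hlaminj : Injective lam := Subtype.val_injective.comp U.equivFin.symm.injective
  refine ⟨U.card, hcard ▸ hcardF, fun l => len (l.val + 1), lam, fun i => len (lam i),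
    fun i => hk.trans ((hUmem _).mp (hlam i)).1, fun i => hpos _ (hlam i), ?_, ?_, ?_⟩
  · let start : Fin (k - 1) ⊕ Fin U.card → ℕ := Sum.elim (fun l => l.val + 1) lam
    have hrun : ∀ x, IsRunStart A k (start x) := by
      rintro (l | i)
      · exact Or.inl (by simp only [start, Sum.elim_inl]; omega)
      · exact (hstart _).mpr (Finset.mem_union_right _ (hlam i))
    have hinj : Injective start := by
      refine Injective.sumElim (fun a b h => Fin.ext (by simpa using h)) hlaminj ?_
      intro l i h
      have := ((hUmem _).mp (hlam i)).1
      omega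
    have hfun : Sum.elim (fun l : Fin (k - 1) => kBlock (l.val + 1) (len (l.val + 1)) k)
        (fun i => kBlock (lam i) (len (lam i)) k) =
        fun x => kBlock (start x) (len (start x)) k := by
      ext (l | i) <;> rfl
    rw [hfun]
    intro x y hxy
    refine Set.disjoint_left.mpr ?_
    rintro n ⟨i, hi, rfl⟩ ⟨j, hj, h⟩
    exact hxy (hinj ((hrun x).eq_of_add_mul_eq hlen (hrun y) hi.le hj.le h))
  · ext n
    simp only [Set.mem_union, Set.mem_iUnion]
    constructor
    · intro hn
      obtain ⟨s, hs, i, hi, rfl⟩ := exists_run_of_mem hk hend n hn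
      rcases Finset.mem_union.mp ((hstart s).mp hs) with h | h
      · have hsk := Finset.mem_range.mp h
        rcases s with _ | s
        · omega
        · exact Or.inl ⟨⟨s, by omega⟩, i, hi, rfl⟩
      · obtain ⟨u, rfl⟩ := hlamsurj s h
        exact Or.inr ⟨u, i, hi, rfl⟩
    · rintro (⟨l, i, hi, rfl⟩ | ⟨u, i, hi, rfl⟩)
      exacts [hlen _ i hi, hlen _ i hi]
  · ext n
    rw [Finset.mem_coe, hF]
    simp only [Finset.mem_union, Finset.mem_image, Finset.mem_range, Set.mem_union,
      Set.mem_singleton_iff, Set.mem_ofPred_eq]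
    constructor
    · rintro (h | ⟨s, h | h, rfl⟩)
      · exact Or.inl (Or.inr (hlamsurj n h))
      · rcases s with _ | s
        · simp [hlen0]
        · exact Or.inl (Or.inl (Or.inr ⟨⟨s, by omega⟩, rfl⟩))
      · obtain ⟨u, rfl⟩ := hlamsurj s h
        exact Or.inr ⟨u, rfl⟩
    · rintro (((rfl | ⟨l, rfl⟩) | ⟨i, rfl⟩) | ⟨i, rfl⟩)
      · exact Or.inr ⟨0, Or.inl hk, by simp [hlen0]⟩
      · exact Or.inr ⟨l.val + 1, Or.inl (by omega), rfl⟩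
      · exact Or.inl (hlam i)
      · exact Or.inr ⟨lam i, Or.inr (hlam i), rfl⟩
end

section
/- Structure of p-cyclic Maya diagrams (converse direction): let k ≥ 1, j ≥ 0, let α₁, …, α_{k−1} ≥ 0 be natural numbers and λ₁, …, λ_j, μ₁, …, μ_j ≥ 1 positive integers, and assume that the enlarged blocks (l | α_l + 1)_k for l = 1, …, k−1 and (λ_i | μ_i + 1)_k for i = 1, …, j are pairwise disjoint. Let M be the canonical Maya diagram whose positive part is M₊ = ⋃_{l=1}^{k−1} (l | α_l)_k ∪ ⋃_{i=1}^{j} (λ_i | μ_i)_k, and let F = {0} ∪ {l + α_l·k : 1 ≤ l ≤ k−1} ∪ {λ_i : 1 ≤ i ≤ j} ∪ {λ_i + μ_i·k : 1 ≤ i ≤ j}. Then F has exactly p = k + 2j elements and M Δ F = M ⊕ k; in particular M is p-cyclic with translation k. -/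
open Function

theorem add_mul_mem_kBlock {r s k i : ℕ} (hi : i < s) : r + i * k ∈ kBlock r s k :=
  ⟨i, hi, rfl⟩

theorem add_mul_mem_kBlock_iff {r s k i : ℕ} (hk : 1 ≤ k) :
    r + i * k ∈ kBlock r s k ↔ i < s := by
  refine ⟨?_, add_mul_mem_kBlock⟩
  rintro ⟨i', hi', h⟩
  rwa [Nat.eq_of_mul_eq_mul_right hk (Nat.add_left_cancel h)]

theorem kBlock_subset_succ (r s k : ℕ) : kBlock r s k ⊆ kBlock r (s + 1) k := by
  rintro n ⟨i, hi, rfl⟩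
  exact add_mul_mem_kBlock (hi.trans (Nat.lt_succ_self s))

theorem natCast_mem_mayaShift_iff {M : Set ℤ} (hM : IsCanonicalMaya M) (n k : ℕ) :
    (n : ℤ) ∈ mayaShift M k ↔ n < k ∨ ∃ m ∈ mayaPos M, n = m + k := by
  constructor
  · rintro ⟨a, ha, h⟩
    dsimp only at h
    rcases lt_or_ge a 0 with h0 | h0
    · left; omega
    · lift a to ℕ using h0
      exact Or.inr ⟨a, ha, by omega⟩
  · rintro (h | ⟨m, hm, rfl⟩)
    · exact ⟨n - k, hM.1 _ (by omega), by simp⟩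
    · exact ⟨m, hm, by simp⟩

theorem mem_mayaShift_of_neg {M : Set ℤ} (hM : IsCanonicalMaya M) {n : ℤ} (hn : n < 0) (k : ℕ) :
    n ∈ mayaShift M k :=
  ⟨n - k, hM.1 _ (by omega), by simp⟩

theorem natCast_mem_finsetFlips_iff {F : Finset ℕ} {n : ℕ} :
    (n : ℤ) ∈ finsetFlips F ↔ n ∈ F := by
  simp [finsetFlips]

theorem not_mem_finsetFlips_of_neg {F : Finset ℕ} {n : ℤ} (hn : n < 0) : n ∉ finsetFlips F := by
  rintro ⟨m, -, rfl⟩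
  simp only at hn
  omega

/-- structure of p-cyclic Maya diagrams, converse direction:
given `k ≥ 1`, `j ≥ 0`, Okamoto data `α` and second-type data `λ, μ ≥ 1` whose
enlarged blocks are pairwise disjoint, the canonical Maya diagram `M` whose positive
part is the union of the blocks `(l | αₗ)_k` and `(λᵢ | μᵢ)_k` satisfies
`M Δ F = M ⊕ k` for the flip set
`F = {0} ∪ {l + αₗ k} ∪ {λᵢ} ∪ {λᵢ + μᵢ k}`, which has exactly `k + 2j` elements;
in particular `M` is `(k + 2j)`-cyclic with translation `k`. -/
theorem cyclic_maya_structure_converse (k j : ℕ) (hk : 1 ≤ k)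
    (α : Fin (k - 1) → ℕ) (lam mu : Fin j → ℕ)
    (hlam : ∀ i, 1 ≤ lam i) (hmu : ∀ i, 1 ≤ mu i)
    (hdisj : Pairwise (Disjoint on (Sum.elim
      (fun l : Fin (k - 1) => kBlock (l.val + 1) (α l + 1) k)
      (fun i : Fin j => kBlock (lam i) (mu i + 1) k))))
    (M : Set ℤ) (hM : IsCanonicalMaya M)
    (hpos : mayaPos M = (⋃ l : Fin (k - 1), kBlock (l.val + 1) (α l) k) ∪
      (⋃ i : Fin j, kBlock (lam i) (mu i) k))
    (F : Finset ℕ)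
    (hF : F = insert 0
      ((Finset.univ.image (fun l : Fin (k - 1) => (l.val + 1) + α l * k)) ∪
       (Finset.univ.image (fun i : Fin j => lam i)) ∪
       (Finset.univ.image (fun i : Fin j => lam i + mu i * k)))) :
    F.card = k + 2 * j ∧ symmDiff M (finsetFlips F) = mayaShift M (k : ℤ) := by
  have hAA : ∀ {l l' n}, n ∈ kBlock (l.val + 1) (α l + 1) k →
      n ∈ kBlock (l'.val + 1) (α l' + 1) k → l = l' := by
    intro l l' n h h'
    by_contra hne
    exact Set.disjoint_left.1 (hdisj (Sum.inl_injective.ne hne)) h h'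
  have hBB : ∀ {i i' n}, n ∈ kBlock (lam i) (mu i + 1) k →
      n ∈ kBlock (lam i') (mu i' + 1) k → i = i' := by
    intro i i' n h h'
    by_contra hne
    exact Set.disjoint_left.1 (hdisj (Sum.inr_injective.ne hne)) h h'
  have hAB : ∀ {l i n}, n ∈ kBlock (l.val + 1) (α l + 1) k →
      n ∉ kBlock (lam i) (mu i + 1) k := by
    intro l i n h h'
    exact Set.disjoint_left.1 (hdisj (Sum.inl_ne_inr (a := l) (b := i))) h h'
  have hAtop : ∀ l, l.val + 1 + α l * k ∈ kBlock (l.val + 1) (α l + 1) k :=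
    fun l => add_mul_mem_kBlock (Nat.lt_succ_self _)
  have hBtop : ∀ i, lam i + mu i * k ∈ kBlock (lam i) (mu i + 1) k :=
    fun i => add_mul_mem_kBlock (Nat.lt_succ_self _)
  have hBbot : ∀ {i n}, lam i = n → n ∈ kBlock (lam i) (mu i + 1) k := fun {i n} h =>
    ⟨0, Nat.succ_pos _, by simp [h]⟩
  have hmemF : ∀ n, n ∈ F ↔ n = 0 ∨ (∃ l : Fin (k - 1), l.val + 1 + α l * k = n) ∨
      (∃ i, lam i = n) ∨ ∃ i, lam i + mu i * k = n := by
    intro n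
    simp [hF]
  have hmemM : ∀ n, n ∈ mayaPos M ↔ (∃ l : Fin (k - 1), n ∈ kBlock (l.val + 1) (α l) k) ∨
      ∃ i, n ∈ kBlock (lam i) (mu i) k := by
    intro n
    simp [hpos]
  have hlt : ∀ {n}, n < k → n ≠ 0 → ∃ l : Fin (k - 1), n = l.val + 1 := fun {n} h h0 =>
    ⟨⟨n - 1, by omega⟩, by simp only; omega⟩
  constructor
  · rw [hF, Finset.card_insert_of_notMem, Finset.card_union_of_disjoint,
      Finset.card_union_of_disjoint, Finset.card_image_of_injective,
      Finset.card_image_of_injective, Finset.card_image_of_injective]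
    · simp only [Finset.card_univ, Fintype.card_fin]
      omega
    · intro i i' h
      exact hBB (hBtop i) (by simpa only [h] using hBtop i')
    · intro i i' h
      exact hBB (hBbot h) (hBbot rfl)
    · intro l l' h
      exact hAA (hAtop l) (by simpa only [h] using hAtop l')
    · simp only [Finset.disjoint_left, Finset.mem_image, Finset.mem_univ, true_and]
      rintro n ⟨l, rfl⟩ ⟨i, h⟩
      exact hAB (hAtop l) (hBbot h)
    · simp only [Finset.disjoint_left, Finset.mem_union, Finset.mem_image, Finset.mem_univ,
        true_and]
      rintro n (⟨l, rfl⟩ | ⟨i', rfl⟩) ⟨i, h⟩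
      · exact hAB (hAtop l) (h ▸ hBtop i)
      · obtain rfl : i' = i := hBB (hBbot rfl) (h ▸ hBtop i)
        have := Nat.mul_pos (hmu i') hk
        omega
    · simp only [Finset.mem_union, Finset.mem_image, Finset.mem_univ, true_and]
      rintro ((⟨l, h⟩ | ⟨i, h⟩) | ⟨i, h⟩)
      · omega
      · have := hlam i
        omega
      · have := hlam i
        omega
  · ext z
    rcases lt_or_ge z 0 with hz | hz
    · have h1 := hM.1 z hz
      have h2 := not_mem_finsetFlips_of_neg (F := F) hz
      have h3 := mem_mayaShift_of_neg hM hz k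
      simp [Set.mem_symmDiff, h1, h2, h3]
    lift z to ℕ using hz with n
    rw [Set.mem_symmDiff, natCast_mem_finsetFlips_iff, natCast_mem_mayaShift_iff hM]
    change (n ∈ mayaPos M ∧ _ ∨ _ ∧ n ∉ mayaPos M) ↔ _
    by_cases hA : ∃ l : Fin (k - 1), n ∈ kBlock (l.val + 1) (α l + 1) k
    · obtain ⟨l, c, hc, rfl⟩ := hA
      have hmem := add_mul_mem_kBlock (r := l.val + 1) (k := k) hc
      have hMiff : l.val + 1 + c * k ∈ mayaPos M ↔ c < α l := by
        rw [hmemM, ← add_mul_mem_kBlock_iff (r := l.val + 1) hk]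
        constructor
        · rintro (⟨l', h⟩ | ⟨i, h⟩)
          · obtain rfl := hAA hmem (kBlock_subset_succ _ _ _ h)
            exact h
          · exact (hAB hmem (kBlock_subset_succ _ _ _ h)).elim
        · exact fun h => Or.inl ⟨l, h⟩
      have hFiff : l.val + 1 + c * k ∈ F ↔ c = α l := by
        rw [hmemF]
        constructor
        · rintro (h | ⟨l', h⟩ | ⟨i, h⟩ | ⟨i, h⟩)
          · omega
          · obtain rfl := hAA hmem (h ▸ hAtop l')
            exact (Nat.eq_of_mul_eq_mul_right hk (Nat.add_left_cancel h)).symm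
          · exact (hAB hmem (hBbot h)).elim
          · exact (hAB hmem (h ▸ hBtop i)).elim
        · rintro rfl
          exact Or.inr (Or.inl ⟨l, rfl⟩)
      have hS : l.val + 1 + c * k < k ∨ ∃ m ∈ mayaPos M, l.val + 1 + c * k = m + k := by
        cases c with
        | zero => left; omega
        | succ c =>
          exact Or.inr ⟨l.val + 1 + c * k, (hmemM _).2 (Or.inl ⟨l, add_mul_mem_kBlock (by omega)⟩),
            by ring⟩
      rw [hMiff, hFiff]
      simp only [hS, iff_true]
      omega
    by_cases hB : ∃ i, n ∈ kBlock (lam i) (mu i + 1) k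
    · obtain ⟨i, c, hc, rfl⟩ := hB
      have hmem := add_mul_mem_kBlock (r := lam i) (k := k) hc
      have hMiff : lam i + c * k ∈ mayaPos M ↔ c < mu i := by
        rw [hmemM, ← add_mul_mem_kBlock_iff (r := lam i) hk]
        constructor
        · rintro (⟨l, h⟩ | ⟨i', h⟩)
          · exact (hA ⟨l, kBlock_subset_succ _ _ _ h⟩).elim
          · obtain rfl := hBB hmem (kBlock_subset_succ _ _ _ h)
            exact h
        · exact fun h => Or.inr ⟨i, h⟩
      have hFiff : lam i + c * k ∈ F ↔ c = 0 ∨ c = mu i := by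
        rw [hmemF]
        constructor
        · rintro (h | ⟨l, h⟩ | ⟨i', h⟩ | ⟨i', h⟩)
          · have := hlam i
            omega
          · exact (hA ⟨l, h ▸ hAtop l⟩).elim
          · obtain rfl := hBB hmem (hBbot h)
            left
            have : c * k = 0 := by omega
            exact (Nat.mul_eq_zero.1 this).resolve_right (by omega)
          · obtain rfl := hBB hmem (h ▸ hBtop i')
            exact Or.inr (Nat.eq_of_mul_eq_mul_right hk (Nat.add_left_cancel h)).symm
        · rintro (rfl | rfl)
          · exact Or.inr (Or.inr (Or.inl ⟨i, by simp⟩))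
          · exact Or.inr (Or.inr (Or.inr ⟨i, rfl⟩))
      have hSiff : (lam i + c * k < k ∨ ∃ m ∈ mayaPos M, lam i + c * k = m + k) ↔ c ≠ 0 := by
        constructor
        · rintro (h | ⟨m, hm, h⟩) rfl
          · have := hlam i
            obtain ⟨l, hl⟩ := hlt h (by omega)
            exact hA ⟨l, 0, Nat.succ_pos _, by omega⟩
          · rcases (hmemM m).1 hm with ⟨l, d, hd, rfl⟩ | ⟨i', d, hd, rfl⟩
            · exact hA ⟨l, d + 1, by omega, by rw [h]; ring⟩
            · obtain rfl := hBB (i' := i') hmem ⟨d + 1, by omega, by rw [h]; ring⟩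
              omega
        · intro h
          obtain ⟨c, rfl⟩ := Nat.exists_eq_succ_of_ne_zero h
          exact Or.inr ⟨lam i + c * k, (hmemM _).2 (Or.inr ⟨i, add_mul_mem_kBlock (by omega)⟩),
            by rw [Nat.succ_mul]; ring⟩
      rw [hMiff, hFiff, hSiff]
      have := hmu i
      omega
    · have hnM : n ∉ mayaPos M := by
        rw [hmemM]
        rintro (⟨l, h⟩ | ⟨i, h⟩)
        · exact hA ⟨l, kBlock_subset_succ _ _ _ h⟩
        · exact hB ⟨i, kBlock_subset_succ _ _ _ h⟩
      have hFiff : n ∈ F ↔ n = 0 := by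
        rw [hmemF]
        refine ⟨?_, Or.inl⟩
        rintro (h | ⟨l, rfl⟩ | ⟨i, rfl⟩ | ⟨i, rfl⟩)
        · exact h
        · exact (hA ⟨l, hAtop l⟩).elim
        · exact (hB ⟨i, hBbot rfl⟩).elim
        · exact (hB ⟨i, hBtop i⟩).elim
      have hSiff : (n < k ∨ ∃ m ∈ mayaPos M, n = m + k) ↔ n = 0 := by
        constructor
        · rintro (h | ⟨m, hm, rfl⟩)
          · by_contra h0
            obtain ⟨l, hl⟩ := hlt h h0
            exact hA ⟨l, 0, Nat.succ_pos _, by omega⟩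
          · rcases (hmemM m).1 hm with ⟨l, d, hd, rfl⟩ | ⟨i, d, hd, rfl⟩
            · exact (hA ⟨l, d + 1, by omega, by ring⟩).elim
            · exact (hB ⟨i, d + 1, by omega, by ring⟩).elim
        · rintro rfl
          exact Or.inl hk
      simp [hnM, hFiff, hSiff]
end

section
/- Regularity of 3-Okamoto extensions: for natural numbers α₁, α₂ ≥ 0, let Ω_{α₁,α₂} = {1 + 3i : 0 ≤ i < α₁} ∪ {2 + 3i : 0 ≤ i < α₂}, and let H^{Ω_{α₁,α₂}}(z) be the Wronskian of the Hermite polynomials H_n with n ranging over Ω_{α₁,α₂} in increasing order. Then H^{Ω_{α₁,α₂}} has no real zeros if and only if α₁ = α₂. -/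
/-- The physicists' Hermite polynomials:
`H₀ = 1`, `H₁ = 2x`, `H_{n+1} = 2x·H_n − 2n·H_{n-1}`. -/
noncomputable def hermiteH : ℕ → Polynomial ℝ
  | 0 => 1
  | 1 => Polynomial.C 2 * Polynomial.X
  | n + 2 => Polynomial.C 2 * Polynomial.X * hermiteH (n + 1)
      - Polynomial.C (2 * ((n : ℝ) + 1)) * hermiteH n

/-- The Wronskian of a list of functions: the determinant of the matrix whose
`(i, j)` entry is the `i`-th derivative of the `j`-th function (0-indexed);
the empty Wronskian is `1`. -/
noncomputable def wronskian (fs : List (ℝ → ℝ)) (z : ℝ) : ℝ :=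
  Matrix.det (Matrix.of fun i j : Fin fs.length => iteratedDeriv i.val (fs.get j) z)

/-- The Wronskian of the Hermite polynomials indexed by a finite set `S ⊆ ℕ`,
taken in increasing order. -/
noncomputable def hermiteWronskian (S : Finset ℕ) (z : ℝ) : ℝ :=
  wronskian ((S.sort (· ≤ ·)).map fun n => fun x => (hermiteH n).eval x) z

/-- The 3-Okamoto Maya diagram `Ω_{α₁,α₂} = {1+3i : i < α₁} ∪ {2+3i : i < α₂}`. -/
def OmegaMaya (a1 a2 : ℕ) : Finset ℕ :=
  ((Finset.range a1).image fun i => 1 + 3 * i) ∪ ((Finset.range a2).image fun i => 2 + 3 * i)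

namespace HermiteWronskian

open Polynomial MeasureTheory Filter Topology

/-! ### Polynomials against the Gaussian weight -/

lemma integrable_eval_mul_exp_neg_sq (p : ℝ[X]) {b : ℝ} (hb : 0 < b) :
    Integrable fun x : ℝ => p.eval x * Real.exp (-b * x ^ 2) := by
  induction p using Polynomial.induction_on' with
  | add p q hp hq =>
    simp only [eval_add, add_mul]
    exact hp.add hq
  | monomial n a =>
    have h := integrable_rpow_mul_exp_neg_mul_sq hb (s := (n : ℝ))
      (by linarith [(Nat.cast_nonneg n : (0 : ℝ) ≤ n)])
    simpa [mul_assoc] using h.const_mul a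

lemma tendsto_eval_mul_exp_neg_sq (p : ℝ[X]) :
    Tendsto (fun x : ℝ => p.eval x * Real.exp (-x ^ 2)) (cocompact ℝ) (𝓝 0) := by
  induction p using Polynomial.induction_on' with
  | add p q hp hq => simpa [add_mul] using hp.add hq
  | monomial n a =>
    have h := tendsto_rpow_abs_mul_exp_neg_mul_sq_cocompact one_pos (n : ℝ)
    have h' : Tendsto (fun x : ℝ => x ^ n * Real.exp (-x ^ 2)) (cocompact ℝ) (𝓝 0) := by
      refine tendsto_zero_iff_norm_tendsto_zero.2 (h.congr fun x => ?_)
      simp [Real.rpow_natCast]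
    simpa [mul_assoc] using h'.const_mul a

lemma integrable_weighted (p : ℝ[X]) :
    Integrable fun x : ℝ => p.eval x * Real.exp (-x ^ 2) := by
  simpa using integrable_eval_mul_exp_neg_sq p one_pos

/-- The operator `-∂² + 2x∂`, of which `hermiteH n` is an eigenvector with eigenvalue `2n`. -/
noncomputable def hermiteOp : Module.End ℝ ℝ[X] where
  toFun p := C 2 * X * derivative p - derivative (derivative p)
  map_add' p q := by simp; ring
  map_smul' c p := by simp [smul_eq_C_mul]; ring

lemma hermiteOp_apply (p : ℝ[X]) :
    hermiteOp p = C 2 * X * derivative p - derivative (derivative p) := rfl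

lemma hasDerivAt_greens (u v : ℝ[X]) (x : ℝ) :
    HasDerivAt (fun x => (u * derivative v - derivative u * v).eval x * Real.exp (-x ^ 2))
      ((hermiteOp u * v - u * hermiteOp v).eval x * Real.exp (-x ^ 2)) x := by
  have h1 := (u * derivative v - derivative u * v).hasDerivAt x
  have h2 : HasDerivAt (fun x : ℝ => Real.exp (-x ^ 2)) (Real.exp (-x ^ 2) * -(2 * x)) x := by
    simpa using ((hasDerivAt_pow 2 x).neg).exp
  refine (h1.mul h2).congr_deriv ?_
  simp [hermiteOp_apply]
  ring

/-- The Gaussian integral of a polynomial over the half-line `(z, ∞)`. -/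
noncomputable def tailInt (z : ℝ) (p : ℝ[X]) : ℝ :=
  ∫ x in Set.Ioi z, p.eval x * Real.exp (-x ^ 2)

/-- The Gaussian integral of a polynomial over the real line. -/
noncomputable def fullInt (p : ℝ[X]) : ℝ :=
  ∫ x, p.eval x * Real.exp (-x ^ 2)

lemma tailInt_add (z : ℝ) (p q : ℝ[X]) : tailInt z (p + q) = tailInt z p + tailInt z q := by
  simp only [tailInt, eval_add, add_mul]
  exact integral_add (integrable_weighted p).integrableOn (integrable_weighted q).integrableOn

lemma tailInt_sub (z : ℝ) (p q : ℝ[X]) : tailInt z (p - q) = tailInt z p - tailInt z q := by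
  simp only [tailInt, eval_sub, sub_mul]
  exact integral_sub (integrable_weighted p).integrableOn (integrable_weighted q).integrableOn

lemma tailInt_smul (z c : ℝ) (p : ℝ[X]) : tailInt z (c • p) = c * tailInt z p := by
  simp only [tailInt, eval_smul, smul_eq_mul, mul_assoc]
  exact integral_const_mul _ _

lemma tailInt_sum {ι : Type*} (z : ℝ) (t : Finset ι) (f : ι → ℝ[X]) :
    tailInt z (∑ i ∈ t, f i) = ∑ i ∈ t, tailInt z (f i) := by
  classical
  induction t using Finset.induction_on with
  | empty => simp [tailInt]
  | insert a t ha ih => rw [Finset.sum_insert ha, Finset.sum_insert ha, tailInt_add, ih]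

lemma tailInt_greens (z : ℝ) (u v : ℝ[X]) :
    tailInt z (hermiteOp u * v) - tailInt z (u * hermiteOp v) =
      (derivative u * v - u * derivative v).eval z * Real.exp (-z ^ 2) := by
  rw [← tailInt_sub, tailInt, integral_Ioi_of_hasDerivAt_of_tendsto'
    (fun x _ => hasDerivAt_greens u v x) (integrable_weighted _).integrableOn
    ((tendsto_eval_mul_exp_neg_sq _).mono_left atTop_le_cocompact)]
  simp
  ring

lemma fullInt_greens (u v : ℝ[X]) :
    fullInt (hermiteOp u * v) = fullInt (u * hermiteOp v) := by
  have h := integral_of_hasDerivAt_of_tendsto (hasDerivAt_greens u v) (integrable_weighted _)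
    ((tendsto_eval_mul_exp_neg_sq _).mono_left atBot_le_cocompact)
    ((tendsto_eval_mul_exp_neg_sq _).mono_left atTop_le_cocompact)
  simp only [eval_sub, sub_mul, sub_self] at h
  rw [integral_sub (integrable_weighted _) (integrable_weighted _)] at h
  exact sub_eq_zero.1 h

lemma hasDerivAt_tailInt (p : ℝ[X]) (z : ℝ) :
    HasDerivAt (fun z => tailInt z p) (-(p.eval z * Real.exp (-z ^ 2))) z := by
  have hc : Continuous fun x : ℝ => p.eval x * Real.exp (-x ^ 2) := by fun_prop
  have h : (fun z => tailInt z p) = fun z => tailInt 0 p -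
      ∫ x in (0 : ℝ)..z, p.eval x * Real.exp (-x ^ 2) := by
    funext z
    rw [tailInt, tailInt, ← intervalIntegral.integral_Ioi_sub_Ioi'
      (integrable_weighted p).integrableOn (integrable_weighted p).integrableOn]
    ring
  rw [h]
  exact (hc.integral_hasStrictDerivAt 0 z).hasDerivAt.const_sub _

lemma tendsto_tailInt_atTop (p : ℝ[X]) : Tendsto (fun z => tailInt z p) atTop (𝓝 0) := by
  have h := intervalIntegral_tendsto_integral_Ioi 0 (integrable_weighted p).integrableOn tendsto_id
  have h2 := (tendsto_const_nhds (x := tailInt 0 p)).sub h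
  rw [tailInt, sub_self] at h2
  refine h2.congr fun z => ?_
  rw [id, ← intervalIntegral.integral_Ioi_sub_Ioi'
      (integrable_weighted p).integrableOn (integrable_weighted p).integrableOn, tailInt]
  ring

lemma tendsto_tailInt_atBot (p : ℝ[X]) : Tendsto (fun z => tailInt z p) atBot (𝓝 (fullInt p)) := by
  have h := intervalIntegral_tendsto_integral_Iic 0 (integrable_weighted p).integrableOn tendsto_id
  have h2 := h.add (tendsto_const_nhds (x := tailInt 0 p))
  rw [tailInt, intervalIntegral.integral_Iic_add_Ioi (integrable_weighted p).integrableOn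
    (integrable_weighted p).integrableOn] at h2
  refine h2.congr fun z => ?_
  rw [id, ← intervalIntegral.integral_Ioi_sub_Ioi'
      (integrable_weighted p).integrableOn (integrable_weighted p).integrableOn, tailInt]
  ring

lemma fullInt_mul_self_pos {p : ℝ[X]} (hp : p ≠ 0) : 0 < fullInt (p * p) := by
  have hc : Continuous fun x : ℝ => (p * p).eval x * Real.exp (-x ^ 2) := by fun_prop
  obtain ⟨x, hx⟩ : ∃ x, p.eval x ≠ 0 := by
    by_contra! h
    exact hp (Polynomial.funext (by simpa using h))
  refine integral_pos_of_integrable_nonneg_nonzero (x := x) hc (integrable_weighted _) ?_ ?_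
  · intro y
    simp only [eval_mul, Pi.zero_apply]
    exact mul_nonneg (mul_self_nonneg _) (Real.exp_pos _).le
  · simpa using hx

/-! ### Hermite polynomials -/

lemma hermiteH_succ_succ (n : ℕ) : hermiteH (n + 2) =
    C 2 * X * hermiteH (n + 1) - C (2 * ((n : ℝ) + 1)) * hermiteH n := by
  rw [hermiteH]

lemma derivative_hermiteH_succ (n : ℕ) :
    derivative (hermiteH (n + 1)) = C (2 * ((n : ℝ) + 1)) * hermiteH n := by
  induction n using Nat.twoStepInduction with
  | zero => simp [hermiteH]
  | one => simp [hermiteH]; ring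
  | more n h1 h2 =>
    rw [hermiteH_succ_succ (n + 1)]
    simp only [derivative_sub, derivative_mul, derivative_C, derivative_X, h1, h2]
    rw [hermiteH_succ_succ n]
    push_cast
    simp only [C_mul, C_add, C_1, map_ofNat]
    ring

lemma hermiteOp_hermiteH (n : ℕ) : hermiteOp (hermiteH n) = (2 * n : ℝ) • hermiteH n := by
  rw [hermiteOp_apply, smul_eq_C_mul]
  match n with
  | 0 => simp [hermiteH]
  | 1 => simp [hermiteH]; ring
  | n + 2 =>
    rw [derivative_hermiteH_succ (n + 1)]
    simp only [derivative_mul, derivative_C, derivative_hermiteH_succ n]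
    rw [hermiteH_succ_succ n]
    push_cast
    simp only [C_mul, C_add, C_1, map_ofNat]
    ring

lemma hermiteH_ne_zero (n : ℕ) : hermiteH n ≠ 0 := by
  induction n with
  | zero => simp [hermiteH]
  | succ n ih =>
    intro h
    have h' := derivative_hermiteH_succ n
    rw [h, derivative_zero, eq_comm, mul_eq_zero, C_eq_zero] at h'
    exact h'.elim (by positivity) ih

lemma hasEigenvector_hermiteH (n : ℕ) :
    Module.End.HasEigenvector hermiteOp (2 * n : ℝ) (hermiteH n) :=
  ⟨Module.End.mem_eigenspace_iff.2 (hermiteOp_hermiteH n), hermiteH_ne_zero n⟩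

lemma aeval_hermiteOp_hermiteH (q : ℝ[X]) (n : ℕ) :
    aeval hermiteOp q (hermiteH n) = q.eval (2 * n : ℝ) • hermiteH n :=
  Module.End.aeval_apply_of_hasEigenvector (hasEigenvector_hermiteH n)

lemma linearIndependent_hermiteH : LinearIndependent ℝ hermiteH :=
  Module.End.eigenvectors_linearIndependent' hermiteOp (fun n : ℕ => (2 * n : ℝ))
    (fun m n h => by simpa using h) hermiteH hasEigenvector_hermiteH

lemma fullInt_hermiteH_mul {m n : ℕ} (h : m ≠ n) : fullInt (hermiteH m * hermiteH n) = 0 := by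
  have h1 := fullInt_greens (hermiteH m) (hermiteH n)
  have h2 : ∀ (c : ℝ) (p : ℝ[X]), fullInt (c • p) = c * fullInt p := fun c p => by
    simp only [fullInt, eval_smul, smul_eq_mul, mul_assoc]
    exact integral_const_mul _ _
  rw [hermiteOp_hermiteH, hermiteOp_hermiteH, smul_mul_assoc, mul_smul_comm, h2, h2,
    ← sub_eq_zero, ← sub_mul, mul_eq_zero] at h1
  refine h1.resolve_left fun h3 => h ?_
  exact_mod_cast (by linarith : (m : ℝ) = n)

lemma span_hermiteH : Submodule.span ℝ (Set.range hermiteH) = ⊤ := by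
  set S := Submodule.span ℝ (Set.range hermiteH) with hS
  have hmem : ∀ n, hermiteH n ∈ S := fun n => Submodule.subset_span ⟨n, rfl⟩
  have hX : ∀ n, X * hermiteH n ∈ S := by
    intro n
    match n with
    | 0 =>
      have : X * hermiteH 0 = (1 / 2 : ℝ) • hermiteH 1 := by
        simp [hermiteH, smul_eq_C_mul, ← mul_assoc, ← C_mul]
      rw [this]
      exact S.smul_mem _ (hmem 1)
    | n + 1 =>
      have : X * hermiteH (n + 1) =
          (1 / 2 : ℝ) • hermiteH (n + 2) + ((n : ℝ) + 1) • hermiteH n := by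
        have hC : (C (1 / 2 : ℝ)) * 2 = 1 := by rw [← map_ofNat C 2, ← C_mul]; norm_num
        rw [hermiteH_succ_succ, smul_eq_C_mul, smul_eq_C_mul]
        simp only [C_mul, C_add, C_1, map_ofNat]
        linear_combination ((C (n : ℝ) + 1) * hermiteH n - X * hermiteH (n + 1)) * hC
      rw [this]
      exact S.add_mem (S.smul_mem _ (hmem _)) (S.smul_mem _ (hmem _))
  have hmul : ∀ p ∈ S, X * p ∈ S := by
    intro p hp
    induction hp using Submodule.span_induction with
    | mem p h => obtain ⟨n, rfl⟩ := h; exact hX n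
    | zero => simp
    | add p q _ _ hp hq => rw [mul_add]; exact S.add_mem hp hq
    | smul c p _ hp => rw [mul_smul_comm]; exact S.smul_mem _ hp
  have hpow : ∀ n : ℕ, (X : ℝ[X]) ^ n ∈ S := by
    intro n
    induction n with
    | zero => simpa [hermiteH] using hmem 0
    | succ n ih => rw [pow_succ']; exact hmul _ ih
  refine eq_top_iff.2 fun p _ => ?_
  rw [p.as_sum_range_C_mul_X_pow]
  refine S.sum_mem fun i _ => ?_
  rw [← smul_eq_C_mul]
  exact S.smul_mem _ (hpow i)

/-! ### Order of vanishing and boundary terms -/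

/-- The polynomial `u` vanishes to order at least `m` at `z`. -/
def Vanishes (z : ℝ) (m : ℕ) (u : ℝ[X]) : Prop :=
  ∀ i < m, (derivative^[i] u).eval z = 0

lemma Vanishes.mono {z : ℝ} {m n : ℕ} {u : ℝ[X]} (h : Vanishes z n u) (hmn : m ≤ n) :
    Vanishes z m u := fun i hi => h i (hi.trans_le hmn)

lemma iterate_derivative_hermiteOp (u : ℝ[X]) (i : ℕ) :
    derivative^[i] (hermiteOp u) = C 2 * X * derivative^[i + 1] u
      + C (2 * (i : ℝ)) * derivative^[i] u - derivative^[i + 2] u := by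
  induction i with
  | zero => simp [hermiteOp_apply]
  | succ i ih =>
    rw [Function.iterate_succ_apply', ih]
    simp only [derivative_add, derivative_sub, derivative_mul, derivative_C, derivative_X,
      ← Function.iterate_succ_apply' (⇑derivative)]
    push_cast
    simp only [C_mul, C_add, C_1]
    ring

lemma Vanishes.hermiteOp_pow {z : ℝ} {u : ℝ[X]} {m : ℕ} (i : ℕ) (h : Vanishes z (m + 2 * i) u) :
    Vanishes z m ((hermiteOp ^ i) u) ∧ (derivative^[m] ((hermiteOp ^ i) u)).eval z =
      (-1) ^ i * (derivative^[m + 2 * i] u).eval z := by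
  induction i generalizing m with
  | zero => exact ⟨by simpa using h, by simp⟩
  | succ i ih =>
    obtain ⟨h1, h2⟩ := ih (m := m + 2) (h.mono (by lia))
    rw [pow_succ', Module.End.mul_apply]
    constructor
    · intro j hj
      rw [iterate_derivative_hermiteOp]
      simp only [eval_sub, eval_add, eval_mul, h1 j (by lia), h1 (j + 1) (by lia),
        h1 (j + 2) (by lia), mul_zero, add_zero, sub_zero]
    · rw [iterate_derivative_hermiteOp]
      simp only [eval_sub, eval_add, eval_mul, h1 m (by lia), h1 (m + 1) (by lia), h2]
      rw [show m + 2 + 2 * i = m + 2 * (i + 1) by ring]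
      ring

lemma tailInt_hermiteOp_pow {z : ℝ} {u : ℝ[X]} (i : ℕ) (h : Vanishes z (2 * i) u) (v : ℝ[X]) :
    tailInt z ((hermiteOp ^ i) u * v) = tailInt z (u * (hermiteOp ^ i) v) := by
  induction i generalizing v with
  | zero => simp
  | succ i ih =>
    have hv := (Vanishes.hermiteOp_pow (m := 2) i (h.mono (by lia))).1
    have h0 := hv 0 (by lia)
    have h1 := hv 1 (by lia)
    simp only [Function.iterate_zero, id, Function.iterate_one] at h0 h1
    have hg := tailInt_greens z ((hermiteOp ^ i) u) v
    simp only [eval_sub, eval_mul, h0, h1] at hg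
    rw [pow_succ', Module.End.mul_apply, sub_eq_zero.1 (hg.trans (by ring)),
      ih (h.mono (by lia)), ← Module.End.mul_apply, ← pow_succ, pow_succ']

lemma tailInt_aeval_mul (z : ℝ) (q u v : ℝ[X]) {n : ℕ} (hn : q.natDegree < n) :
    tailInt z (aeval hermiteOp q u * v) =
      ∑ i ∈ Finset.range n, q.coeff i * tailInt z ((hermiteOp ^ i) u * v) := by
  rw [aeval_eq_sum_range' hn, LinearMap.sum_apply, Finset.sum_mul, tailInt_sum]
  refine Finset.sum_congr rfl fun i _ => ?_
  rw [LinearMap.smul_apply, smul_mul_assoc, tailInt_smul]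

lemma tailInt_mul_aeval (z : ℝ) (q u v : ℝ[X]) {n : ℕ} (hn : q.natDegree < n) :
    tailInt z (u * aeval hermiteOp q v) =
      ∑ i ∈ Finset.range n, q.coeff i * tailInt z (u * (hermiteOp ^ i) v) := by
  rw [mul_comm, tailInt_aeval_mul z q v u hn]
  simp only [mul_comm u]

lemma tailInt_aeval_symm {z : ℝ} {q u : ℝ[X]} {m : ℕ} (hq : q.natDegree ≤ m)
    (h : Vanishes z (2 * m) u) (v : ℝ[X]) :
    tailInt z (aeval hermiteOp q u * v) = tailInt z (u * aeval hermiteOp q v) := by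
  rw [tailInt_aeval_mul z q u v (Nat.lt_succ_of_le hq),
    tailInt_mul_aeval z q u v (Nat.lt_succ_of_le hq)]
  refine Finset.sum_congr rfl fun i hi => ?_
  rw [tailInt_hermiteOp_pow i (h.mono (by have := Finset.mem_range.1 hi; lia))]

lemma tailInt_hermiteOp_pow_of_le {z : ℝ} {u v : ℝ[X]} {s i : ℕ} (hi : i ≤ s)
    (hu : Vanishes z (s + 1) u) (hv : Vanishes z s v) :
    tailInt z ((hermiteOp ^ i) u * v) = tailInt z (u * (hermiteOp ^ i) v) := by
  obtain ⟨a, b, rfl, ha, hb⟩ : ∃ a b, i = a + b ∧ 2 * a ≤ s ∧ 2 * b ≤ s + 1 :=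
    ⟨i / 2, i - i / 2, by lia, by lia, by lia⟩
  rw [pow_add, Module.End.mul_apply, mul_comm, ← tailInt_hermiteOp_pow a (hv.mono ha), mul_comm,
    tailInt_hermiteOp_pow b (hu.mono hb), ← Module.End.mul_apply, ← pow_add, add_comm b a, pow_add]

lemma tailInt_hermiteOp_pow_succ {z : ℝ} {u v : ℝ[X]} {s : ℕ}
    (hu : Vanishes z (s + 1) u) (hv : Vanishes z s v) :
    tailInt z ((hermiteOp ^ (s + 1)) u * v) = tailInt z (u * (hermiteOp ^ (s + 1)) v) +
      (derivative^[s + 1] u).eval z * (derivative^[s] v).eval z * Real.exp (-z ^ 2) := by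
  obtain ⟨a, b, hab, ha, hb⟩ : ∃ a b, s = a + b ∧ 2 * a ≤ s ∧ 2 * b ≤ s + 1 :=
    ⟨s / 2, s - s / 2, by lia, by lia, by lia⟩
  have hg := tailInt_greens z ((hermiteOp ^ b) u) ((hermiteOp ^ a) v)
  have hsplit : hermiteOp ^ (s + 1) = hermiteOp ^ a * (hermiteOp * hermiteOp ^ b) := by
    rw [← pow_succ', ← pow_add, hab, add_assoc]
  have hsplit' : hermiteOp ^ (s + 1) = hermiteOp ^ b * (hermiteOp * hermiteOp ^ a) := by
    rw [← pow_succ', ← pow_add, hab, ← add_assoc, add_comm b a]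
  have hl : tailInt z ((hermiteOp ^ (s + 1)) u * v) =
      tailInt z (hermiteOp ((hermiteOp ^ b) u) * (hermiteOp ^ a) v) := by
    rw [hsplit, Module.End.mul_apply, mul_comm, ← tailInt_hermiteOp_pow a (hv.mono ha), mul_comm,
      Module.End.mul_apply]
  have hr : tailInt z (u * (hermiteOp ^ (s + 1)) v) =
      tailInt z ((hermiteOp ^ b) u * hermiteOp ((hermiteOp ^ a) v)) := by
    rw [hsplit', Module.End.mul_apply, ← tailInt_hermiteOp_pow b (hu.mono hb),
      Module.End.mul_apply]
  rw [hl, hr, ← sub_eq_iff_eq_add', hg]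
  congr 1
  rcases Nat.lt_or_ge (2 * a) s with hlt | hge
  · obtain ⟨rfl, rfl⟩ : b = a + 1 ∧ s = 2 * a + 1 := by lia
    have hu0 := (Vanishes.hermiteOp_pow (m := 0) (a + 1) (hu.mono (by lia))).2
    obtain ⟨hv0, hv1⟩ := Vanishes.hermiteOp_pow (m := 1) a (hv.mono (by lia))
    have hv0 := hv0 0 (by lia)
    simp only [Function.iterate_zero, id, Function.iterate_one] at hu0 hv0 hv1
    rw [show 0 + 2 * (a + 1) = 2 * a + 1 + 1 by ring] at hu0
    rw [show 1 + 2 * a = 2 * a + 1 by ring] at hv1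
    simp only [eval_sub, eval_mul, hu0, hv0, hv1]
    have h1 : ((-1 : ℝ) ^ a) ^ 2 = 1 := by rw [← pow_mul, mul_comm, pow_mul]; simp
    linear_combination (derivative^[2 * a + 1 + 1] u).eval z *
      (derivative^[2 * a + 1] v).eval z * h1
  · obtain ⟨rfl, rfl⟩ : a = b ∧ s = 2 * a := by lia
    have hv0 := (Vanishes.hermiteOp_pow (m := 0) a (hv.mono (by lia))).2
    obtain ⟨hu0, hu1⟩ := Vanishes.hermiteOp_pow (m := 1) a (hu.mono (by lia))
    have hu0 := hu0 0 (by lia)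
    simp only [Function.iterate_zero, id, Function.iterate_one] at hv0 hu0 hu1
    rw [show 0 + 2 * a = 2 * a by ring] at hv0
    rw [show 1 + 2 * a = 2 * a + 1 by ring] at hu1
    simp only [eval_sub, eval_mul, hu0, hv0, hu1]
    have h1 : ((-1 : ℝ) ^ a) ^ 2 = 1 := by rw [← pow_mul, mul_comm, pow_mul]; simp
    linear_combination (derivative^[2 * a + 1] u).eval z * (derivative^[2 * a] v).eval z * h1

lemma tailInt_aeval_boundary {z : ℝ} {q u v : ℝ[X]} {s : ℕ} (hq : q.natDegree = s + 1)
    (hmonic : q.Monic) (hu : Vanishes z (s + 1) u) (hv : Vanishes z s v) :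
    tailInt z (aeval hermiteOp q u * v) = tailInt z (u * aeval hermiteOp q v) +
      (derivative^[s + 1] u).eval z * (derivative^[s] v).eval z * Real.exp (-z ^ 2) := by
  have hlt : q.natDegree < s + 2 := by lia
  rw [tailInt_aeval_mul z q u v hlt, tailInt_mul_aeval z q u v hlt, Finset.sum_range_succ,
    Finset.sum_range_succ _ (s + 1), tailInt_hermiteOp_pow_succ hu hv, ← hq,
    hmonic.coeff_natDegree, hq]
  rw [Finset.sum_congr rfl fun i hi => by
    rw [tailInt_hermiteOp_pow_of_le (Nat.lt_succ_iff.1 (Finset.mem_range.1 hi)) hu hv]]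
  ring

/-! ### The Wronskian as a polynomial -/

/-- The Wronskian matrix of the Hermite polynomials `hermiteH (k j)`. -/
noncomputable def wronskianMatrix {s : ℕ} (k : Fin s → ℕ) : Matrix (Fin s) (Fin s) ℝ[X] :=
  Matrix.of fun i j => derivative^[i] (hermiteH (k j))

/-- The monic polynomial with roots `2 * k j`. -/
noncomputable def spectralPoly {s : ℕ} (k : Fin s → ℕ) : ℝ[X] :=
  ∏ j, (X - C (2 * k j : ℝ))

lemma spectralPoly_monic {s : ℕ} (k : Fin s → ℕ) : (spectralPoly k).Monic :=
  monic_prod_of_monic _ _ fun _ _ => monic_X_sub_C _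

lemma natDegree_spectralPoly {s : ℕ} (k : Fin s → ℕ) : (spectralPoly k).natDegree = s := by
  rw [spectralPoly, natDegree_prod_of_monic _ _ fun _ _ => monic_X_sub_C _]
  simp only [natDegree_X_sub_C, Finset.sum_const, Finset.card_univ, Fintype.card_fin, smul_eq_mul,
    mul_one]

lemma eval_spectralPoly {s : ℕ} (k : Fin s → ℕ) (x : ℝ) :
    (spectralPoly k).eval x = ∏ j, (x - 2 * k j) := by
  simp [spectralPoly, eval_prod]

lemma eval_spectralPoly_self {s : ℕ} (k : Fin s → ℕ) (j : Fin s) :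
    (spectralPoly k).eval (2 * k j : ℝ) = 0 := by
  rw [eval_spectralPoly]
  exact Finset.prod_eq_zero (Finset.mem_univ j) (sub_self _)

lemma eval_det_wronskianMatrix {s : ℕ} (k : Fin s → ℕ) (z : ℝ) :
    (wronskianMatrix k).det.eval z =
      (Matrix.of fun i j : Fin s => (derivative^[i] (hermiteH (k j))).eval z).det := by
  rw [← coe_evalRingHom, RingHom.map_det]
  rfl

lemma aeval_sum_smul_hermiteH {s : ℕ} (q : ℝ[X]) (k : Fin s → ℕ) (c : Fin s → ℝ)
    (hq : ∀ j, q.eval (2 * k j : ℝ) = 0) :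
    aeval hermiteOp q (∑ j, c j • hermiteH (k j)) = 0 := by
  rw [map_sum]
  refine Finset.sum_eq_zero fun j _ => ?_
  rw [map_smul, aeval_hermiteOp_hermiteH, hq, zero_smul, smul_zero]

lemma eval_iterate_derivative_sum {s : ℕ} (k : Fin s → ℕ) (c : Fin s → ℝ) (i : ℕ) (z : ℝ) :
    (derivative^[i] (∑ j, c j • hermiteH (k j))).eval z =
      ∑ j, c j * (derivative^[i] (hermiteH (k j))).eval z := by
  simp [iterate_derivative_sum, eval_finsetSum, iterate_derivative_smul]

lemma tendsto_eval_mul_exp_neg_sq_div (p d : ℝ[X]) :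
    Tendsto (fun x : ℝ => p.eval x * Real.exp (-x ^ 2) / d.eval x) (cocompact ℝ) (𝓝 0) := by
  rcases le_or_gt d.degree 0 with h | h
  · rw [eq_C_of_degree_le_zero h]
    simpa using (tendsto_eval_mul_exp_neg_sq p).div_const (d.coeff 0)
  · have h1 := d.tendsto_norm_atTop h (tendsto_norm_cocompact_atTop (E := ℝ))
    have h2 : Tendsto (fun x => (d.eval x)⁻¹) (cocompact ℝ) (𝓝 0) := by
      rw [tendsto_zero_iff_norm_tendsto_zero]
      simp only [norm_inv]
      exact h1.inv_tendsto_atTop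
    simpa [div_eq_mul_inv] using (tendsto_eval_mul_exp_neg_sq p).mul h2

/-- A missing level `n` at which `spectralPoly k` is negative forces a real zero of the
Wronskian. -/
theorem exists_eval_det_wronskianMatrix_eq_zero {s : ℕ} (k : Fin (s + 1) → ℕ) {n : ℕ}
    (hn : (spectralPoly k).eval (2 * n : ℝ) < 0) :
    ∃ z, (wronskianMatrix k).det.eval z = 0 := by
  by_contra! hW
  have hkn : ∀ j, n ≠ k j := by
    rintro j rfl
    exact hn.ne (eval_spectralPoly_self k j)
  set W := (wronskianMatrix k).det with hWdef
  set N : Fin (s + 1) → ℝ[X] := (wronskianMatrix k).adjugate.mulVec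
    fun i => -derivative^[i] (hermiteH n) with hN
  have hcramer : ∀ i : Fin (s + 1), ∑ j, derivative^[i] (hermiteH (k j)) * N j =
      -(W * derivative^[i] (hermiteH n)) := by
    intro i
    have h : (wronskianMatrix k).mulVec N = W • fun i : Fin (s + 1) =>
        -derivative^[i] (hermiteH n) := by
      rw [hN, Matrix.mulVec_mulVec, Matrix.mul_adjugate, Matrix.smul_mulVec, Matrix.one_mulVec]
    have h := congrFun h i
    simpa [Matrix.mulVec, dotProduct, wronskianMatrix] using h
  set c : Fin (s + 1) → ℝ → ℝ := fun j z => (N j).eval z / W.eval z with hc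
  have hcd : ∀ j z, HasDerivAt (c j) (deriv (c j) z) z := fun j z =>
    (((N j).differentiableAt).div W.differentiableAt (hW z)).hasDerivAt
  set φ : ℝ → ℝ[X] := fun z => hermiteH n + ∑ j, c j z • hermiteH (k j) with hφ
  set χ : ℝ → ℝ[X] := fun z => ∑ j, deriv (c j) z • hermiteH (k j) with hχ
  have heval : ∀ i z, (derivative^[i] (φ z)).eval z = (derivative^[i] (hermiteH n)).eval z +
      ∑ j, c j z * (derivative^[i] (hermiteH (k j))).eval z := by
    intro i z
    rw [hφ, iterate_map_add, eval_add, eval_iterate_derivative_sum]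
  have hφv : ∀ z, Vanishes z (s + 1) (φ z) := by
    intro z i hi
    have h := congrArg (eval z) (hcramer ⟨i, hi⟩)
    simp only [eval_finsetSum, eval_mul, eval_neg] at h
    rw [heval, ← mul_right_inj' (hW z), mul_add, Finset.mul_sum, mul_zero, ← sub_eq_zero.2 h,
      sub_neg_eq_add, add_comm]
    congr 1
    refine Finset.sum_congr rfl fun j _ => ?_
    rw [← mul_assoc, mul_div_cancel₀ _ (hW z), mul_comm]
  have hχφ : ∀ z, ∀ i < s + 1, (derivative^[i] (χ z)).eval z =
      -(derivative^[i + 1] (φ z)).eval z := by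
    intro z i hi
    have h0 : (fun y => (derivative^[i] (hermiteH n)).eval y +
        ∑ j, c j y * (derivative^[i] (hermiteH (k j))).eval y) = fun _ => 0 := by
      funext y
      rw [← heval, hφv y i hi]
    have h1 : HasDerivAt (fun y => (derivative^[i] (hermiteH n)).eval y +
        ∑ j, c j y * (derivative^[i] (hermiteH (k j))).eval y) _ z :=
      (Polynomial.hasDerivAt _ z).add (HasDerivAt.fun_sum fun j _ =>
        (hcd j z).mul (Polynomial.hasDerivAt _ z))
    rw [h0] at h1
    have h2 := h1.unique (hasDerivAt_const z 0)
    simp only [← Function.iterate_succ_apply' (⇑derivative), Finset.sum_add_distrib] at h2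
    rw [eval_iterate_derivative_sum, heval]
    linarith
  have hχv : ∀ z, Vanishes z s (χ z) := fun z i hi => by
    rw [hχφ z i (by lia), hφv z (i + 1) (by lia), neg_zero]
  set J : ℝ → ℝ := fun z => tailInt z (hermiteH n * hermiteH n) +
    ∑ j, c j z * tailInt z (hermiteH n * hermiteH (k j)) with hJ
  have hJd : ∀ z, HasDerivAt J (tailInt z (hermiteH n * χ z)) z := by
    intro z
    have h1 : HasDerivAt J _ z := (hasDerivAt_tailInt (hermiteH n * hermiteH n) z).add
      (HasDerivAt.fun_sum (u := Finset.univ) fun j _ =>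
        (hcd j z).mul (hasDerivAt_tailInt (hermiteH n * hermiteH (k j)) z))
    refine h1.congr_deriv ?_
    have h2 := hφv z 0 (by lia)
    rw [heval] at h2
    simp only [Function.iterate_zero, id] at h2
    rw [hχ, Finset.mul_sum, tailInt_sum, Finset.sum_add_distrib]
    simp only [mul_smul_comm, tailInt_smul, eval_mul]
    have h3 : ∑ j, c j z * -((hermiteH n).eval z * (hermiteH (k j)).eval z * Real.exp (-z ^ 2)) =
        -(hermiteH n).eval z * Real.exp (-z ^ 2) * ∑ j, c j z * (hermiteH (k j)).eval z := by
      rw [Finset.mul_sum]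
      exact Finset.sum_congr rfl fun j _ => by ring
    rw [h3]
    linear_combination -(hermiteH n).eval z * Real.exp (-z ^ 2) * h2
  have hJmono : Monotone J := by
    refine monotone_of_deriv_nonneg (fun z => (hJd z).differentiableAt) fun z => ?_
    rw [(hJd z).deriv]
    have h1 := tailInt_aeval_boundary (natDegree_spectralPoly k) (spectralPoly_monic k)
      (hφv z) (hχv z)
    rw [hχφ z s (by lia), aeval_sum_smul_hermiteH _ k _ (eval_spectralPoly_self k), hφ, map_add,
      aeval_sum_smul_hermiteH _ k _ (eval_spectralPoly_self k), aeval_hermiteOp_hermiteH,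
      add_zero, smul_mul_assoc, tailInt_smul, mul_zero] at h1
    have h2 : tailInt z 0 = 0 := by simp [tailInt]
    rw [h2, zero_add] at h1
    refine nonneg_of_mul_nonpos_right (h1.trans_le ?_) hn
    rw [mul_neg, neg_mul, neg_nonpos]
    exact mul_nonneg (mul_self_nonneg _) (Real.exp_pos _).le
  have hlim : ∀ j, Tendsto (fun z => c j z * tailInt z (hermiteH n * hermiteH (k j)))
      (cocompact ℝ) (𝓝 0) := by
    intro j
    set R := derivative (hermiteH n) * hermiteH (k j) - hermiteH n * derivative (hermiteH (k j))
    have hne : (2 * n - 2 * k j : ℝ) ≠ 0 := by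
      have : (n : ℝ) ≠ k j := by exact_mod_cast hkn j
      intro h
      exact this (by linarith)
    have h1 := (tendsto_eval_mul_exp_neg_sq_div (N j * R) W).div_const (2 * n - 2 * k j : ℝ)
    rw [zero_div] at h1
    refine h1.congr fun z => ?_
    have h2 := tailInt_greens z (hermiteH n) (hermiteH (k j))
    rw [hermiteOp_hermiteH, hermiteOp_hermiteH, smul_mul_assoc, mul_smul_comm, tailInt_smul,
      tailInt_smul, ← sub_mul] at h2
    rw [div_eq_iff hne, hc, eval_mul]
    linear_combination -((N j).eval z / W.eval z) * h2
  have hsum : Tendsto (fun z => ∑ j, c j z * tailInt z (hermiteH n * hermiteH (k j)))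
      (cocompact ℝ) (𝓝 0) := by
    simpa using tendsto_finsetSum Finset.univ fun j _ => hlim j
  have htop : Tendsto J atTop (𝓝 (0 + 0)) :=
    (tendsto_tailInt_atTop _).add (hsum.mono_left atTop_le_cocompact)
  have hbot : Tendsto J atBot (𝓝 (fullInt (hermiteH n * hermiteH n) + 0)) :=
    (tendsto_tailInt_atBot _).add (hsum.mono_left atBot_le_cocompact)
  have h1 := hJmono.ge_of_tendsto htop 0
  have h2 := hJmono.le_of_tendsto hbot 0
  have h3 := fullInt_mul_self_pos (hermiteH_ne_zero n)
  linarith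

/-! ### Completeness of the Hermite functions -/

/-- An exponentially integrable function all of whose moments vanish is zero. -/
lemma ae_eq_zero_of_moments_eq_zero {h : ℝ → ℝ}
    (hexp : ∀ t : ℝ, Integrable fun x => h x * Real.exp (t * |x|))
    (hmom : ∀ n : ℕ, ∫ x, h x * x ^ n = 0) : h =ᵐ[volume] 0 := by
  have h_int : Integrable h := by simpa using hexp 0
  have hfourier : ∀ t : ℝ, ∫ x : ℝ, Complex.exp (t * x * Complex.I) * (h x : ℂ) = 0 := by
    intro t
    have hs := hasSum_integral_of_dominated_convergence (μ := volume)
      (F := fun (n : ℕ) (x : ℝ) =>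
        ((t * x * Complex.I) ^ n / (n.factorial : ℂ)) * (h x : ℂ))
      (f := fun x : ℝ => Complex.exp (t * x * Complex.I) * (h x : ℂ))
      (fun n x => (|t| * |x|) ^ n / n.factorial * |h x|)
      (fun n => by
        have := h_int.aestronglyMeasurable
        have h2 : AEStronglyMeasurable (fun x => (h x : ℂ)) volume :=
          Complex.continuous_ofReal.comp_aestronglyMeasurable this
        exact (by fun_prop : Continuous fun x : ℝ =>
          (t * x * Complex.I) ^ n / (n.factorial : ℂ)).aestronglyMeasurable.mul h2)
      (fun n => Eventually.of_forall fun x => by simp)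
      (Eventually.of_forall fun x => (Real.summable_pow_div_factorial _).mul_right _)
      (by
        have : ∀ x, ∑' n : ℕ, (|t| * |x|) ^ n / n.factorial * |h x| =
            |h x * Real.exp (|t| * |x|)| := fun x => by
          rw [tsum_mul_right, abs_mul, Real.abs_exp, Real.exp_eq_exp_ℝ,
            NormedSpace.exp_eq_tsum_div, mul_comm]
        simp only [this]
        exact (hexp |t|).abs)
      (Eventually.of_forall fun x => by
        refine HasSum.mul_right _ ?_
        rw [Complex.exp_eq_exp_ℂ]
        exact NormedSpace.expSeries_div_hasSum_exp _)
    refine hs.unique ?_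
    have hz : ∀ n : ℕ, ∫ x : ℝ, ((t * x * Complex.I) ^ n / (n.factorial : ℂ)) * (h x : ℂ) = 0 := by
      intro n
      have : ∀ x : ℝ, ((t * x * Complex.I) ^ n / (n.factorial : ℂ)) * (h x : ℂ) =
          ((t * Complex.I) ^ n / (n.factorial : ℂ)) * ((h x * x ^ n : ℝ) : ℂ) := fun x => by
        push_cast
        ring
      simp only [this]
      rw [integral_const_mul, integral_complex_ofReal, hmom]
      simp
    simp only [hz]
    exact hasSum_zero
  have hfin : ∀ g : ℝ → ℝ, Integrable g →
      IsFiniteMeasure (volume.withDensity fun x => ENNReal.ofReal (g x)) := fun g hg =>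
    isFiniteMeasure_withDensity_ofReal hg.2
  have := hfin h h_int
  have := hfin (-h) h_int.neg
  have hchar : ∀ g : ℝ → ℝ, Integrable g → ∀ t : ℝ,
      charFun (volume.withDensity fun x => ENNReal.ofReal (g x)) t =
        ∫ x : ℝ, Complex.exp (t * x * Complex.I) * ((max (g x) 0 : ℝ) : ℂ) := by
    intro g hg t
    rw [charFun_apply_real, integral_withDensity_eq_integral_toReal_smul₀
      hg.aestronglyMeasurable.aemeasurable.ennreal_ofReal (by simp)]
    refine integral_congr_ae (Eventually.of_forall fun x => ?_)
    simp [ENNReal.toReal_ofReal', mul_comm]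
  have hcint : ∀ g : ℝ → ℝ, Integrable g → ∀ t : ℝ,
      Integrable fun x : ℝ => Complex.exp (t * x * Complex.I) * ((max (g x) 0 : ℝ) : ℂ) := by
    intro g hg t
    refine (hg.pos_part.ofReal (𝕜 := ℂ)).bdd_mul (c := 1)
      (by fun_prop : Continuous fun x : ℝ => Complex.exp (t * x * Complex.I)).aestronglyMeasurable
      (Eventually.of_forall fun x => ?_)
    rw [← Complex.ofReal_mul, Complex.norm_exp_ofReal_mul_I]
  have heq : (volume.withDensity fun x => ENNReal.ofReal (h x)) =
      volume.withDensity fun x => ENNReal.ofReal ((-h) x) := by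
    refine Measure.ext_of_charFun (funext fun t => ?_)
    rw [hchar h h_int, hchar (-h) h_int.neg, ← sub_eq_zero,
      ← integral_sub (hcint h h_int t) (hcint (-h) h_int.neg t), ← hfourier t]
    refine integral_congr_ae (Eventually.of_forall fun x => ?_)
    simp only [← mul_sub, ← Complex.ofReal_sub, Pi.neg_apply]
    congr 3
    rcases le_total (h x) 0 with h0 | h0
    · rw [max_eq_right h0, max_eq_left (by linarith)]; ring
    · rw [max_eq_left h0, max_eq_right (by linarith)]; ring
  rw [withDensity_eq_iff h_int.aestronglyMeasurable.aemeasurable.ennreal_ofReal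
    h_int.neg.aestronglyMeasurable.aemeasurable.ennreal_ofReal
    h_int.lintegral_lt_top.ne] at heq
  filter_upwards [heq] with x hx
  rw [Pi.zero_apply]
  simp only [Pi.neg_apply] at hx
  rcases lt_trichotomy (h x) 0 with h0 | h0 | h0
  · rw [ENNReal.ofReal_of_nonpos h0.le, eq_comm, ENNReal.ofReal_eq_zero] at hx
    linarith
  · exact h0
  · rw [ENNReal.ofReal_of_nonpos (by linarith : -h x ≤ 0), ENNReal.ofReal_eq_zero] at hx
    linarith

/-- A polynomial times `exp (-x² / 2)`, cut off to a measurable set, is square-integrable. -/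
lemma memLp_indicator_eval_mul_exp {A : Set ℝ} (hA : MeasurableSet A) (p : ℝ[X]) :
    MemLp (A.indicator fun x : ℝ => p.eval x * Real.exp (-(1 / 2) * x ^ 2)) 2 volume := by
  refine MemLp.indicator hA ?_
  rw [memLp_two_iff_integrable_sq
    (by fun_prop : Continuous fun x : ℝ => p.eval x * Real.exp (-(1 / 2) * x ^ 2)
      ).aestronglyMeasurable]
  refine (integrable_weighted (p * p)).congr (Eventually.of_forall fun x => ?_)
  simp only [eval_mul, mul_pow, ← Real.exp_nat_mul]
  push_cast
  rw [show (2 : ℝ) * (-(1 / 2) * x ^ 2) = -x ^ 2 by ring]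
  ring

/-- The class in `L²` of a polynomial times `exp (-x² / 2)`, cut off to `A`. -/
noncomputable def toL2 {A : Set ℝ} (hA : MeasurableSet A) :
    ℝ[X] →ₗ[ℝ] Lp ℝ 2 (volume : Measure ℝ) where
  toFun p := (memLp_indicator_eval_mul_exp hA p).toLp
  map_add' p q := by
    rw [← MemLp.toLp_add]
    congr 1
    funext x
    by_cases hx : x ∈ A <;> simp [hx, add_mul]
  map_smul' c p := by
    rw [RingHom.id_apply, ← MemLp.toLp_const_smul]
    congr 1
    funext x
    by_cases hx : x ∈ A <;> simp [hx, mul_assoc]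

lemma coeFn_toL2 {A : Set ℝ} (hA : MeasurableSet A) (p : ℝ[X]) :
    toL2 hA p =ᵐ[volume] A.indicator fun x : ℝ => p.eval x * Real.exp (-(1 / 2) * x ^ 2) :=
  MemLp.coeFn_toLp (memLp_indicator_eval_mul_exp hA p)

lemma inner_toL2_toL2 {A B : Set ℝ} (hA : MeasurableSet A) (hB : MeasurableSet B) (p q : ℝ[X]) :
    inner ℝ (toL2 hA p) (toL2 hB q) = ∫ x in A ∩ B, (p * q).eval x * Real.exp (-x ^ 2) := by
  rw [L2.inner_def, ← integral_indicator (hA.inter hB)]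
  refine integral_congr_ae ?_
  filter_upwards [coeFn_toL2 hA p, coeFn_toL2 hB q] with x h1 h2
  rw [h1, h2]
  have h3 : Real.exp (-x ^ 2) = Real.exp (-(1 / 2) * x ^ 2) * Real.exp (-(1 / 2) * x ^ 2) := by
    rw [← Real.exp_add]
    congr 1
    ring
  by_cases hxA : x ∈ A <;> by_cases hxB : x ∈ B <;> simp [hxA, hxB, h3]
  ring

lemma eq_zero_of_forall_inner_toL2_eq_zero {g : Lp ℝ 2 (volume : Measure ℝ)}
    (hg : ∀ p : ℝ[X], inner ℝ (toL2 MeasurableSet.univ p) g = 0) : g = 0 := by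
  have hae : (fun x => g x * Real.exp (-(1 / 2) * x ^ 2)) =ᵐ[volume] 0 := by
    refine ae_eq_zero_of_moments_eq_zero (fun t => ?_) fun n => ?_
    · have h1 : MemLp (fun x : ℝ => Real.exp (-(1 / 2) * x ^ 2) * Real.exp (t * |x|)) 2 volume := by
        rw [memLp_two_iff_integrable_sq (by fun_prop : Continuous fun x : ℝ =>
          Real.exp (-(1 / 2) * x ^ 2) * Real.exp (t * |x|)).aestronglyMeasurable]
        refine Integrable.mono' ((integrable_exp_neg_mul_sq (b := 1 / 2) (by norm_num)).const_mul
          (Real.exp (2 * t ^ 2))) (by fun_prop) (Eventually.of_forall fun x => ?_)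
        rw [Real.norm_of_nonneg (sq_nonneg _), ← Real.exp_add, ← Real.exp_add, ← Real.exp_nat_mul,
          Real.exp_le_exp]
        push_cast
        nlinarith [sq_nonneg (2 * t - |x|), sq_abs x]
      simp only [mul_assoc]
      exact (Lp.memLp g).integrable_mul h1
    · rw [← hg (X ^ n), L2.inner_def]
      refine integral_congr_ae ?_
      filter_upwards [coeFn_toL2 MeasurableSet.univ (X ^ n : ℝ[X])] with x hx
      rw [hx]
      simp
      ring
  rw [Lp.eq_zero_iff_ae_eq_zero]
  filter_upwards [hae] with x hx
  exact (mul_eq_zero.1 hx).resolve_right (Real.exp_pos _).ne'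

lemma inner_toL2_univ (p q : ℝ[X]) :
    inner ℝ (toL2 MeasurableSet.univ p) (toL2 MeasurableSet.univ q) = fullInt (p * q) := by
  simp [inner_toL2_toL2, fullInt]

lemma inner_toL2_Ioi (z : ℝ) (p q : ℝ[X]) :
    inner ℝ (toL2 (measurableSet_Ioi (a := z)) p) (toL2 (measurableSet_Ioi (a := z)) q) =
      tailInt z (p * q) := by
  rw [inner_toL2_toL2, Set.inter_self, tailInt]

lemma inner_toL2_Ioi_univ (z : ℝ) (p q : ℝ[X]) :
    inner ℝ (toL2 (measurableSet_Ioi (a := z)) p) (toL2 MeasurableSet.univ q) =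
      tailInt z (p * q) := by
  rw [inner_toL2_toL2, Set.inter_univ, tailInt]

/-- The normalizing constant of the Hermite function of index `n`. -/
noncomputable def hermiteScale (n : ℕ) : ℝ := ‖toL2 MeasurableSet.univ (hermiteH n)‖⁻¹

lemma hermiteScale_pos (n : ℕ) : 0 < hermiteScale n := by
  rw [hermiteScale, inv_pos, norm_pos_iff, ← inner_self_ne_zero (𝕜 := ℝ), inner_toL2_univ]
  exact (fullInt_mul_self_pos (hermiteH_ne_zero n)).ne'

lemma orthonormal_hermite :
    Orthonormal ℝ fun n => toL2 MeasurableSet.univ (hermiteScale n • hermiteH n) := by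
  constructor
  · intro n
    have h := hermiteScale_pos n
    simp only [map_smul]
    rw [norm_smul, Real.norm_of_nonneg h.le]
    rw [hermiteScale, inv_pos] at h
    exact inv_mul_cancel₀ h.ne'
  · intro m n hmn
    simp only [map_smul]
    rw [inner_smul_left, inner_smul_right, inner_toL2_univ, fullInt_hermiteH_mul hmn]
    simp

/-- The normalized Hermite functions form a Hilbert basis of `L²(ℝ)`. -/
noncomputable def hermiteBasis : HilbertBasis ℕ ℝ (Lp ℝ 2 (volume : Measure ℝ)) :=
  HilbertBasis.mkOfOrthogonalEqBot orthonormal_hermite <| by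
    rw [eq_bot_iff]
    intro g hg
    rw [Submodule.mem_orthogonal] at hg
    refine eq_zero_of_forall_inner_toL2_eq_zero fun p => hg _ ?_
    have hp : p ∈ Submodule.span ℝ (Set.range hermiteH) := span_hermiteH ▸ Submodule.mem_top
    induction hp using Submodule.span_induction with
    | mem p h =>
      obtain ⟨n, rfl⟩ := h
      have h1 : toL2 MeasurableSet.univ (hermiteH n) =
          (hermiteScale n)⁻¹ • toL2 MeasurableSet.univ (hermiteScale n • hermiteH n) := by
        rw [map_smul, inv_smul_smul₀ (hermiteScale_pos n).ne']
      rw [h1]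
      exact Submodule.smul_mem _ _ (Submodule.subset_span ⟨n, rfl⟩)
    | zero => simp
    | add p q _ _ hp hq => rw [map_add]; exact Submodule.add_mem _ hp hq
    | smul c p _ hp => rw [map_smul]; exact Submodule.smul_mem _ _ hp

lemma hermiteBasis_apply (n : ℕ) :
    hermiteBasis n = toL2 MeasurableSet.univ (hermiteScale n • hermiteH n) := by
  rw [hermiteBasis, HilbertBasis.coe_mkOfOrthogonalEqBot]

lemma inner_toL2_Ioi_hermiteBasis (z : ℝ) (p : ℝ[X]) (n : ℕ) :
    inner ℝ (toL2 (measurableSet_Ioi (a := z)) p) (hermiteBasis n) =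
      hermiteScale n * tailInt z (p * hermiteH n) := by
  rw [hermiteBasis_apply, inner_toL2_Ioi_univ, mul_smul_comm, tailInt_smul]

/-! ### Absence of real zeros -/

lemma eq_zero_of_eval_eq_zero_on {p : ℝ[X]} {A : Set ℝ} (hA : A.Infinite)
    (h : ∀ x ∈ A, p.eval x = 0) : p = 0 :=
  eq_zero_of_infinite_isRoot p (hA.mono h)

/-- A polynomial is not the truncation of another one to a half-line unless both vanish. -/
lemma eq_zero_of_toL2_Ioi_eq {z : ℝ} {p q : ℝ[X]}
    (h : toL2 (measurableSet_Ioi (a := z)) p = toL2 MeasurableSet.univ q) : p = 0 := by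
  have hae : ∀ᵐ x : ℝ, (Set.Ioi z).indicator p.eval x = q.eval x := by
    filter_upwards [coeFn_toL2 (measurableSet_Ioi (a := z)) p, coeFn_toL2 MeasurableSet.univ q]
      with x h1 h2
    rw [h, h2] at h1
    by_cases hx : x ∈ Set.Ioi z
    · rw [Set.indicator_of_mem (Set.mem_univ x), Set.indicator_of_mem hx] at h1
      rw [Set.indicator_of_mem hx]
      exact (mul_right_cancel₀ (Real.exp_pos _).ne' h1).symm
    · rw [Set.indicator_of_mem (Set.mem_univ x), Set.indicator_of_notMem hx] at h1
      rw [Set.indicator_of_notMem hx]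
      exact ((mul_eq_zero.1 h1).resolve_right (Real.exp_pos _).ne').symm
  have hinf : ∀ B : Set ℝ, IsOpen B → B.Nonempty →
      (B ∩ {x | (Set.Ioi z).indicator p.eval x = q.eval x}).Infinite := by
    intro B hB hne hfin
    have h1 : volume B = 0 := by
      refine measure_mono_null (fun x hx => ?_)
        (measure_union_null (hfin.measure_zero volume) (ae_iff.1 hae))
      by_cases h : (Set.Ioi z).indicator p.eval x = q.eval x
      · exact Or.inl ⟨hx, h⟩
      · exact Or.inr h
    exact (hB.measure_pos volume hne).ne' h1
  have hq : q = 0 := by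
    refine eq_zero_of_eval_eq_zero_on (hinf (Set.Iio z) isOpen_Iio Set.nonempty_Iio) ?_
    rintro x ⟨hx, hx'⟩
    rw [← hx', Set.indicator_of_notMem (by simpa using (Set.mem_Iio.1 hx).le)]
  refine eq_zero_of_eval_eq_zero_on (hinf (Set.Ioi z) isOpen_Ioi Set.nonempty_Ioi) ?_
  rintro x ⟨hx, hx'⟩
  rw [Set.mem_ofPred_eq, Set.indicator_of_mem hx, hq, eval_zero] at hx'
  exact hx'

/-- If the spectral polynomial of the levels `k j` factors into two polynomials of equal degree
whose product is nonnegative on the spectrum and vanishes there only at the `k j`, then the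
Wronskian has no real zeros. -/
theorem eval_det_wronskianMatrix_ne_zero {m : ℕ} {k : Fin (2 * m) → ℕ}
    (hk : Function.Injective k) {q₁ q₂ : ℝ[X]} (hq₁ : q₁.natDegree ≤ m) (hq₂ : q₂.natDegree ≤ m)
    (hzero : ∀ j, (q₁ * q₂).eval (2 * k j : ℝ) = 0)
    (hpos : ∀ n ∉ Set.range k, 0 < (q₁ * q₂).eval (2 * n : ℝ)) (z : ℝ) :
    (wronskianMatrix k).det.eval z ≠ 0 := by
  intro hW
  rw [eval_det_wronskianMatrix, ← Matrix.exists_mulVec_eq_zero_iff] at hW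
  obtain ⟨c, hc, hMc⟩ := hW
  set p : ℝ[X] := ∑ j, c j • hermiteH (k j) with hp
  have hpv : Vanishes z (2 * m) p := by
    intro i hi
    rw [hp, eval_iterate_derivative_sum]
    simpa [Matrix.mulVec, dotProduct, mul_comm] using congrFun hMc ⟨i, hi⟩
  have hp0 : p ≠ 0 := fun h => hc <| funext <|
    Fintype.linearIndependent_iff.1 (linearIndependent_hermiteH.comp k hk) c h
  set f := toL2 (measurableSet_Ioi (a := z)) p
  set f₁ := toL2 (measurableSet_Ioi (a := z)) (aeval hermiteOp q₁ p)
  set f₂ := toL2 (measurableSet_Ioi (a := z)) (aeval hermiteOp q₂ p)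
  have hcoeff : ∀ q : ℝ[X], q.natDegree ≤ m → ∀ n,
      inner ℝ (toL2 (measurableSet_Ioi (a := z)) (aeval hermiteOp q p)) (hermiteBasis n) =
        q.eval (2 * n : ℝ) * inner ℝ f (hermiteBasis n) := by
    intro q hq n
    rw [inner_toL2_Ioi_hermiteBasis, inner_toL2_Ioi_hermiteBasis, tailInt_aeval_symm hq hpv,
      aeval_hermiteOp_hermiteH, mul_smul_comm, tailInt_smul]
    ring
  have hinner : inner ℝ f₁ f₂ = 0 := by
    rw [inner_toL2_Ioi, tailInt_aeval_symm hq₁ hpv, ← Module.End.mul_apply, ← map_mul,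
      aeval_sum_smul_hermiteH _ k c hzero, mul_zero]
    simp [tailInt]
  have hsum := hermiteBasis.hasSum_inner_mul_inner f₁ f₂
  rw [hinner] at hsum
  have hterm : ∀ n, inner ℝ f₁ (hermiteBasis n) * inner ℝ (hermiteBasis n) f₂ =
      (q₁ * q₂).eval (2 * n : ℝ) * inner ℝ f (hermiteBasis n) ^ 2 := by
    intro n
    rw [real_inner_comm f₂, hcoeff q₁ hq₁, hcoeff q₂ hq₂, eval_mul]
    ring
  have hnonneg : ∀ n, 0 ≤ inner ℝ f₁ (hermiteBasis n) * inner ℝ (hermiteBasis n) f₂ := by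
    intro n
    rw [hterm]
    refine mul_nonneg ?_ (sq_nonneg _)
    by_cases hn : n ∈ Set.range k
    · obtain ⟨j, rfl⟩ := hn
      exact (hzero j).ge
    · exact (hpos n hn).le
  have hzero' := (hasSum_zero_iff_of_nonneg hnonneg).1 hsum
  have hf : ∀ n ∉ Finset.univ.image k, hermiteBasis.repr f n • hermiteBasis n = 0 := by
    intro n hn
    have h1 := congrFun hzero' n
    rw [hterm, Pi.zero_apply] at h1
    have h2 := (mul_eq_zero.1 h1).resolve_left (hpos n (by simpa using hn)).ne'
    rw [HilbertBasis.repr_apply_apply, real_inner_comm, pow_eq_zero_iff two_ne_zero |>.1 h2,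
      zero_smul]
  have hfsum := (hermiteBasis.hasSum_repr f).unique (hasSum_sum_of_ne_finset_zero hf)
  simp only [hermiteBasis_apply, ← map_smul, ← map_sum] at hfsum
  exact hp0 (eq_zero_of_toL2_Ioi_eq hfsum)

/-! ### Wronskians indexed by finite sets -/

theorem iteratedDeriv_eval (p : ℝ[X]) (i : ℕ) (z : ℝ) :
    iteratedDeriv i (fun x => p.eval x) z = (derivative^[i] p).eval z := by
  induction i generalizing p with
  | zero => simp
  | succ i ih =>
    rw [iteratedDeriv_succ', Function.iterate_succ_apply, ← ih]
    congr 1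
    funext x
    exact p.deriv

theorem exists_hermiteWronskian_eq_eval_det {S : Finset ℕ} {s : ℕ} (hs : S.card = s) :
    ∃ k : Fin s → ℕ, Function.Injective k ∧ Set.range k = S ∧
      ∀ z, hermiteWronskian S z = (wronskianMatrix k).det.eval z := by
  have hlen : (S.sort (· ≤ ·)).length = s := (Finset.length_sort _).trans hs
  refine ⟨fun j => (S.sort (· ≤ ·)).get (finCongr hlen.symm j), ?_, ?_, fun z => ?_⟩
  · exact (List.nodup_iff_injective_get.1 (Finset.sort_nodup _ _)).comp (finCongr _).injective
  · rw [show (fun j => (S.sort (· ≤ ·)).get (finCongr hlen.symm j)) =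
      (S.sort (· ≤ ·)).get ∘ finCongr hlen.symm from rfl, EquivLike.range_comp, Set.range_list_get]
    ext x
    simp
  · rw [eval_det_wronskianMatrix, hermiteWronskian, _root_.wronskian]
    have h : ((S.sort (· ≤ ·)).map fun n => fun x => (hermiteH n).eval x).length = s := by
      rw [List.length_map, hlen]
    rw [← Matrix.det_submatrix_equiv_self (finCongr h.symm)]
    congr 1
    ext i j
    simp [iteratedDeriv_eval]

theorem prod_comp_eq_prod {S : Finset ℕ} {s : ℕ} {k : Fin s → ℕ} (hk : Function.Injective k)
    (hS : Set.range k = S) (f : ℕ → ℝ) : ∏ j, f (k j) = ∏ m ∈ S, f m := by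
  have h : Finset.univ.image k = S := by
    rw [← Finset.coe_inj, Finset.coe_image, Finset.coe_univ, Set.image_univ, hS]
  rw [← h, Finset.prod_image hk.injOn]

/-- If the largest element of `S` is isolated from below, the Wronskian has a real zero. -/
theorem exists_hermiteWronskian_eq_zero {S : Finset ℕ} {n : ℕ} (hmem : n + 1 ∈ S) (hn : n ∉ S)
    (hmax : ∀ m ∈ S, m ≤ n + 1) : ∃ z, hermiteWronskian S z = 0 := by
  obtain ⟨s, hs⟩ : ∃ s, S.card = s + 1 :=
    Nat.exists_eq_succ_of_ne_zero (Finset.card_ne_zero_of_mem hmem)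
  obtain ⟨k, hk, hS, h⟩ := exists_hermiteWronskian_eq_eval_det hs
  have hneg : (spectralPoly k).eval (2 * n : ℝ) < 0 := by
    rw [eval_spectralPoly, prod_comp_eq_prod hk hS fun m => (2 * n : ℝ) - 2 * m,
      ← Finset.mul_prod_erase S _ hmem]
    refine mul_neg_of_neg_of_pos (by push_cast; linarith) (Finset.prod_pos fun m hm => ?_)
    obtain ⟨h1, h2⟩ := Finset.mem_erase.1 hm
    have h3 := hmax m h2
    have h4 : m ≠ n := fun h => hn (h ▸ h2)
    have h5 : (m : ℝ) < n := by exact_mod_cast (show m < n by omega)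
    linarith
  simpa only [h] using exists_eval_det_wronskianMatrix_eq_zero k hneg

theorem mem_omegaMaya {a1 a2 n : ℕ} : n ∈ OmegaMaya a1 a2 ↔
    (∃ i < a1, 1 + 3 * i = n) ∨ ∃ i < a2, 2 + 3 * i = n := by
  simp [OmegaMaya]

theorem card_omegaMaya_self (a : ℕ) : (OmegaMaya a a).card = 2 * a := by
  rw [OmegaMaya, Finset.card_union_of_disjoint, Finset.card_image_of_injective,
    Finset.card_image_of_injective, Finset.card_range, two_mul]
  · intro i j h
    simpa using h
  · intro i j h
    simpa using h
  · rw [Finset.disjoint_left]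
    intro n h1 h2
    simp only [Finset.mem_image, Finset.mem_range] at h1 h2
    omega

theorem hermiteWronskian_omegaMaya_self_ne_zero (a : ℕ) (z : ℝ) :
    hermiteWronskian (OmegaMaya a a) z ≠ 0 := by
  obtain ⟨k, hk, hS, h⟩ := exists_hermiteWronskian_eq_eval_det (card_omegaMaya_self a)
  rw [h]
  have heval (x : ℝ) : ((∏ i ∈ Finset.range a, (X - C (2 * (1 + 3 * i) : ℝ))) *
      ∏ i ∈ Finset.range a, (X - C (2 * (2 + 3 * i) : ℝ))).eval x =
      ∏ i ∈ Finset.range a, (x - 2 * (1 + 3 * i)) * (x - 2 * (2 + 3 * i)) := by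
    simp [eval_prod, Finset.prod_mul_distrib]
  refine eval_det_wronskianMatrix_ne_zero hk
    (q₁ := ∏ i ∈ Finset.range a, (X - C (2 * (1 + 3 * i) : ℝ)))
    (q₂ := ∏ i ∈ Finset.range a, (X - C (2 * (2 + 3 * i) : ℝ)))
    (by rw [natDegree_finsetProd_X_sub_C_eq_card, Finset.card_range])
    (by rw [natDegree_finsetProd_X_sub_C_eq_card, Finset.card_range]) (fun j => ?_)
    (fun n hn => ?_) z
  · rw [heval]
    have hj : k j ∈ OmegaMaya a a := by
      rw [← Finset.mem_coe, ← hS]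
      exact Set.mem_range_self j
    obtain ⟨i, hi, h⟩ | ⟨i, hi, h⟩ := mem_omegaMaya.1 hj <;>
    · refine Finset.prod_eq_zero (Finset.mem_range.2 hi) ?_
      rw [← h]
      push_cast
      ring
  · rw [heval]
    rw [hS, Finset.mem_coe, mem_omegaMaya] at hn
    refine Finset.prod_pos fun i hi => ?_
    have hi' := Finset.mem_range.1 hi
    obtain h | h : n ≤ 3 * i ∨ 3 * i + 3 ≤ n := by
      by_contra! h
      refine hn ?_
      obtain h | h : 1 + 3 * i = n ∨ 2 + 3 * i = n := by omega
      · exact Or.inl ⟨i, hi', h⟩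
      · exact Or.inr ⟨i, hi', h⟩
    · have h' : (n : ℝ) ≤ 3 * i := by exact_mod_cast h
      exact mul_pos_of_neg_of_neg (by linarith) (by linarith)
    · have h' : (3 * i + 3 : ℝ) ≤ n := by exact_mod_cast h
      exact mul_pos (by linarith) (by linarith)

theorem exists_hermiteWronskian_omegaMaya_eq_zero {a1 a2 : ℕ} (h : a1 ≠ a2) :
    ∃ z, hermiteWronskian (OmegaMaya a1 a2) z = 0 := by
  obtain h | h := h.lt_or_gt
  · refine exists_hermiteWronskian_eq_zero (n := 3 * a2 - 2) ?_ ?_ ?_ <;>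
      simp only [mem_omegaMaya]
    · exact Or.inr ⟨a2 - 1, by omega, by omega⟩
    · omega
    · omega
  · refine exists_hermiteWronskian_eq_zero (n := 3 * a1 - 3) ?_ ?_ ?_ <;>
      simp only [mem_omegaMaya]
    · exact Or.inl ⟨a1 - 1, by omega, by omega⟩
    · omega
    · omega

end HermiteWronskian

/-- regularity of 3-Okamoto extensions: the Hermite Wronskian
`H^{Ω_{α₁,α₂}}` has no real zeros if and only if `α₁ = α₂`. -/
theorem okamoto_wronskian_regular_iff (a1 a2 : ℕ) :
    (∀ z : ℝ, hermiteWronskian (OmegaMaya a1 a2) z ≠ 0) ↔ a1 = a2 := by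
  refine ⟨fun h => ?_, ?_⟩
  · by_contra hne
    obtain ⟨z, hz⟩ := HermiteWronskian.exists_hermiteWronskian_omegaMaya_eq_zero hne
    exact h z hz
  · rintro rfl
    exact HermiteWronskian.hermiteWronskian_omegaMaya_self_ne_zero a1
end

section
/- Generalized Hermite Maya diagrams (case k = 1): let M be a canonical Maya diagram with positive part M₊ and let F be a finite set of nonnegative integers with |F| = p such that M Δ F = M ⊕ 1. Then p = 2j + 1 is odd, and there exist positive integers λ₁, …, λ_j, μ₁, …, μ_j ≥ 1 with λ_i + μ_i < λ_{i+1} for 1 ≤ i < j such that M₊ is the disjoint union of the intervals {λ_i, λ_i + 1, …, λ_i + μ_i − 1} for i = 1, …, j, and F = {0} ∪ {λ_i : 1 ≤ i ≤ j} ∪ {λ_i + μ_i : 1 ≤ i ≤ j}. -/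
/-- The number of flip levels weakly below `n`, modulo two, decides whether `n` is in `M`. -/
theorem mem_iff_even_count {M : Set ℤ} (hneg : (-1 : ℤ) ∈ M) {F : Finset ℕ}
    (hcyc : symmDiff M (finsetFlips F) = mayaShift M (1 : ℤ)) (n : ℕ) :
    (n : ℤ) ∈ M ↔ Even (Nat.count (· ∈ F) (n + 1)) := by
  have key : ∀ m : ℕ, ((m : ℤ) - 1 ∈ M) ↔ ¬ ((m : ℤ) ∈ M ↔ m ∈ F) := by
    intro m
    have h := Set.ext_iff.1 hcyc (m : ℤ)
    have h1 : (m : ℤ) ∈ mayaShift M 1 ↔ (m : ℤ) - 1 ∈ M := by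
      simp [mayaShift, sub_eq_add_neg]
    have h2 : (m : ℤ) ∈ finsetFlips F ↔ m ∈ F := by
      simp [finsetFlips]
    rw [← h1, ← h, Set.mem_symmDiff, h2]
    tauto
  induction n with
  | zero =>
    have h := key 0
    simp only [Nat.cast_zero, zero_sub, hneg, true_iff] at h
    by_cases h0 : 0 ∈ F <;> simp_all [Nat.count_succ]
  | succ k ih =>
    have h := key (k + 1)
    rw [Nat.cast_succ, add_sub_cancel_right] at h
    replace h := ih.symm.trans h
    rw [Nat.count_succ, Nat.cast_succ]
    by_cases hk : k + 1 ∈ F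
    · simp only [hk, iff_true] at h
      simp only [hk, if_true, Nat.even_add_one]
      tauto
    · simp only [hk, iff_false, not_not] at h
      simp only [hk, if_false, add_zero]
      exact h.symm

/-- The `k`-th element of a finite set bounds `n` exactly when at most `k` elements
lie strictly below `n`. -/
theorem le_nth_iff_count_le {F : Finset ℕ} {k : ℕ} (hk : k < F.card) (n : ℕ) :
    n ≤ Nat.nth (· ∈ F) k ↔ Nat.count (· ∈ F) n ≤ k := by
  have hk' : ∀ hf : (Set.ofPred (· ∈ F)).Finite, k < hf.toFinset.card := fun hf => by
    rwa [show hf.toFinset = F by ext; simp]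
  constructor
  · intro h
    exact (Nat.count_monotone _ h).trans (Nat.count_nth hk').le
  · intro h
    by_contra! hlt
    have := Nat.count_monotone (· ∈ F) (Nat.succ_le_of_lt hlt)
    rw [Nat.succ_eq_add_one, Nat.count_nth_succ hk'] at this
    omega

/-- generalized Hermite Maya diagrams, case `k = 1`: if a canonical Maya
diagram `M` is sent to `M ⊕ 1` by the `p` flips of a finite set `F` of nonnegative
integers, then `p = 2j + 1` is odd and there are positive integers `λᵢ, μᵢ ≥ 1` with
`λᵢ + μᵢ < λ_{i+1}` such that the positive part of `M` is the disjoint union of the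
intervals `{λᵢ, …, λᵢ + μᵢ - 1}` and `F = {0} ∪ {λᵢ} ∪ {λᵢ + μᵢ}`. -/
theorem generalized_hermite_maya_structure (M : Set ℤ) (hM : IsCanonicalMaya M) (p : ℕ)
    (F : Finset ℕ) (hcard : F.card = p)
    (hcyc : symmDiff M (finsetFlips F) = mayaShift M (1 : ℤ)) :
    ∃ j : ℕ, p = 2 * j + 1 ∧
      ∃ lam mu : Fin j → ℕ,
        (∀ i, 1 ≤ lam i) ∧ (∀ i, 1 ≤ mu i) ∧
        (∀ (i : Fin j) (h : i.val + 1 < j), lam i + mu i < lam ⟨i.val + 1, h⟩) ∧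
        mayaPos M = (⋃ i : Fin j, {n : ℕ | lam i ≤ n ∧ n < lam i + mu i}) ∧
        (↑F : Set ℕ) = {0} ∪ {n : ℕ | ∃ i : Fin j, n = lam i}
          ∪ {n : ℕ | ∃ i : Fin j, n = lam i + mu i} := by
  have hmem := mem_iff_even_count (hM.1 (-1) (by norm_num)) hcyc
  obtain ⟨-, h0, hfin⟩ := hM
  subst hcard
  set c := Nat.count (· ∈ F) with hc
  set e := Nat.nth (· ∈ F) with he
  have hle : ∀ k < F.card, ∀ n, n ≤ e k ↔ c n ≤ k := fun k hk => le_nth_iff_count_le hk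
  have hlt : ∀ k < F.card, ∀ n, e k ≤ n ↔ k < c (n + 1) := fun k hk n => by
    have := hle k hk (n + 1)
    omega
  have hcF : ∀ n, c n ≤ F.card := fun n => by
    rw [hc, Nat.count_eq_card_filter_range]
    exact Finset.card_le_card fun x hx => (Finset.mem_filter.1 hx).2
  have hcmem : ∀ n, n ∈ F ↔ ∃ k < F.card, n = e k := by
    intro n
    constructor
    · intro h
      refine ⟨c n, ?_, (Nat.nth_count (p := (· ∈ F)) h).symm⟩
      have := hcF (n + 1)
      rw [hc, Nat.count_succ, if_pos h] at this
      exact this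
    · rintro ⟨k, hk, rfl⟩
      exact Nat.nth_mem (p := (· ∈ F)) k fun hf => by
        rwa [show hf.toFinset = F by ext; simp]
  have h0F : 0 < c 1 ∧ c 0 = 0 := by
    have h := (hmem 0).not.1 (by simpa using h0)
    refine ⟨Nat.pos_of_ne_zero fun h' => h ?_, Nat.count_zero _⟩
    rw [zero_add, h']
    exact Even.zero
  have hstrict : ∀ k, k + 1 < F.card → e k < e (k + 1) := fun k hk => by
    have h1 := (hle k (by omega) (e k)).1 le_rfl
    have h2 := (hlt (k + 1) hk (e k)).not
    have h3 := hle k (by omega) (e k + 1)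
    have h4 : c (e k + 1) ≤ c (e k) + 1 := by
      rw [hc, Nat.count_succ]
      split_ifs <;> omega
    omega
  have he0 : e 0 = 0 := by
    have h1 := hcF 1
    have := (hlt 0 (by omega) 0).2 h0F.1
    omega
  have hodd : ¬ Even F.card := by
    obtain ⟨N, hN⟩ := hfin.bddAbove
    have hnot : ((F.sup id + (N + 1).toNat : ℕ) : ℤ) ∉ M := fun h => by
      have := hN ⟨h, by positivity⟩
      omega
    rw [hmem] at hnot
    convert hnot using 2
    refine le_antisymm ?_ (hcF _)
    rw [hc, Nat.count_eq_card_filter_range]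
    refine Finset.card_le_card fun x hx => Finset.mem_filter.2 ⟨Finset.mem_range.2 ?_, hx⟩
    have : x ≤ F.sup id := Finset.le_sup (f := id) hx
    omega
  obtain ⟨j, hj⟩ := Nat.not_even_iff_odd.1 hodd
  have hadd : ∀ i : Fin j, e (2 * i + 1) + (e (2 * i + 2) - e (2 * i + 1)) = e (2 * i + 2) :=
    fun i => by
      have : e (2 * i + 1) < e (2 * i + 2) := hstrict (2 * i + 1) (by omega)
      omega
  refine ⟨j, hj, fun i => e (2 * i + 1), fun i => e (2 * i + 2) - e (2 * i + 1),
    fun i => ?_, fun i => ?_, fun i h => ?_, ?_, ?_⟩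
  · have h1 := hle (2 * i + 1) (by omega) 1
    have h2 := hle 0 (by omega) 1
    have h3 : c 1 ≤ c 0 + 1 := by
      rw [hc, Nat.count_succ]
      split_ifs <;> omega
    show 1 ≤ e (2 * i + 1)
    omega
  · have : e (2 * i + 1) < e (2 * i + 2) := hstrict (2 * i + 1) (by omega)
    show 1 ≤ e (2 * i + 2) - e (2 * i + 1)
    omega
  · simp only [hadd]
    exact hstrict (2 * i + 2) (by omega)
  · ext n
    simp only [mayaPos, Set.mem_ofPred_eq, Set.mem_iUnion, hadd, hmem]
    have hpos : 0 < c (n + 1) :=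
      h0F.1.trans_le (Nat.count_monotone _ (by omega))
    have hn := hcF (n + 1)
    constructor
    · rintro ⟨r, hr⟩
      refine ⟨⟨r - 1, by omega⟩, ?_, ?_⟩
      · rw [hlt _ (by simp only; omega)]
        simp only
        omega
      · rw [← Nat.succ_le_iff, Nat.succ_eq_add_one, hle _ (by simp only; omega)]
        simp only
        omega
    · rintro ⟨i, h1, h2⟩
      rw [hlt _ (by omega)] at h1
      rw [← Nat.succ_le_iff, Nat.succ_eq_add_one, hle _ (by omega)] at h2
      exact ⟨i + 1, by omega⟩
  · ext n
    simp only [Finset.mem_coe, Set.mem_union, Set.mem_singleton_iff, Set.mem_ofPred_eq, hadd, hcmem]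
    constructor
    · rintro ⟨k, hk, rfl⟩
      obtain ⟨r, rfl | rfl⟩ := Nat.even_or_odd' k
      · rcases r with _ | r
        · exact Or.inl (Or.inl he0)
        · exact Or.inr ⟨⟨r, by omega⟩, rfl⟩
      · exact Or.inl (Or.inr ⟨⟨r, by omega⟩, rfl⟩)
    · rintro ((rfl | ⟨i, rfl⟩) | ⟨i, rfl⟩)
      · exact ⟨0, by omega, he0.symm⟩
      · exact ⟨2 * i + 1, by omega, rfl⟩
      · exact ⟨2 * i + 2, by omega, rfl⟩
end

section
/- Classification of 3-cyclic Maya diagrams: let M be a canonical Maya diagram with positive part M₊ and let F be a finite set of nonnegative integers with |F| = 3 and M Δ F = M ⊕ k for some k ≥ 1. Then exactly one of the following holds: (i) k = 1 and there exist λ ≥ 1, μ ≥ 1 with M₊ = {λ, λ+1, …, λ+μ−1} (a generalized Hermite block) and F = {0, λ, λ+μ}; or (ii) k = 3 and there exist α₁, α₂ ≥ 0 with M₊ = {1 + 3i : 0 ≤ i < α₁} ∪ {2 + 3i : 0 ≤ i < α₂} (a 3-Okamoto Maya diagram) and F = {0, 1 + 3α₁, 2 + 3α₂}. -/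
theorem Finset.exists_eq_of_zero_mem_of_card_eq_three {F : Finset ℕ} (h0 : 0 ∈ F)
    (hcard : F.card = 3) : ∃ a b : ℕ, 0 < a ∧ a < b ∧ F = {0, a, b} := by
  have h2 : (F.erase 0).card = 2 := by rw [Finset.card_erase_of_mem h0, hcard]
  obtain ⟨x, y, hxy, hF⟩ := Finset.card_eq_two.mp h2
  have hx : x ≠ 0 := Finset.ne_of_mem_erase (hF ▸ by simp : x ∈ F.erase 0)
  have hy : y ≠ 0 := Finset.ne_of_mem_erase (hF ▸ by simp : y ∈ F.erase 0)
  have hF' : F = {0, x, y} := by rw [← Finset.insert_erase h0, hF]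
  rcases Nat.lt_or_gt_of_ne hxy with h | h
  · exact ⟨x, y, by omega, h, hF'⟩
  · exact ⟨y, x, by omega, h, by rw [hF', Finset.pair_comm]⟩

/-- A level is flipped exactly when its membership differs from that of the level `k` below. -/
theorem mem_iff_of_symmDiff_eq_mayaShift {M : Set ℤ} {k : ℕ} {F : Finset ℕ}
    (hcyc : symmDiff M (finsetFlips F) = mayaShift M (k : ℤ)) (n : ℕ) :
    (n : ℤ) ∈ M ↔ ¬ (n ∈ F ↔ (n : ℤ) - k ∈ M) := by
  have h := Set.ext_iff.mp hcyc n
  have h1 : (n : ℤ) ∈ finsetFlips F ↔ n ∈ F := by simp [finsetFlips]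
  have h2 : (n : ℤ) ∈ mayaShift M k ↔ (n : ℤ) - k ∈ M := by
    constructor
    · rintro ⟨m, hm, hmn⟩
      have : (n : ℤ) - k = m := by simp only at hmn; omega
      rwa [this]
    · exact fun h => ⟨_, h, by simp⟩
  rw [Set.mem_symmDiff, h1, h2] at h
  tauto

/-- With three flips, a level belongs to `M` exactly when an even number of flips lie weakly
below it in its residue class modulo `k`. -/
theorem mem_iff_of_three_flips {M : Set ℤ} (hneg : ∀ n : ℤ, n < 0 → n ∈ M) {k : ℕ}
    (hk : 1 ≤ k) {a b : ℕ} (ha : 0 < a) (hab : a < b)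
    (hcyc : symmDiff M (finsetFlips {0, a, b}) = mayaShift M (k : ℤ)) (n : ℕ) :
    (n : ℤ) ∈ M ↔
      ¬ (n % k = 0 ↔ ((a ≤ n ∧ a % k = n % k) ↔ (b ≤ n ∧ b % k = n % k))) := by
  induction n using Nat.strong_induction_on with
  | _ n ih =>
    have hstep := mem_iff_of_symmDiff_eq_mayaShift hcyc n
    simp only [Finset.mem_insert, Finset.mem_singleton] at hstep
    rcases lt_or_ge n k with hn | hn
    · have hM : (n : ℤ) - k ∈ M := hneg _ (by omega)
      have small : ∀ x : ℕ, (x ≤ n ∧ x % k = n % k) ↔ n = x := by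
        intro x
        constructor
        · rintro ⟨h1, h2⟩
          rw [Nat.mod_eq_of_lt hn, Nat.mod_eq_of_lt (by omega)] at h2
          exact h2.symm
        · rintro rfl
          exact ⟨le_rfl, rfl⟩
      rw [small a, small b, Nat.mod_eq_of_lt hn, hstep]
      grind
    · obtain ⟨m, rfl⟩ := Nat.exists_eq_add_of_le' hn
      have hm : ((m + k : ℕ) : ℤ) - k = (m : ℤ) := by push_cast; ring
      have step : ∀ x : ℕ, (x ≤ m + k ∧ x % k = m % k) ↔
          (m + k = x ∨ (x ≤ m ∧ x % k = m % k)) := by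
        intro x
        constructor
        · rintro ⟨h1, h2⟩
          by_cases hx : x ≤ m
          · exact Or.inr ⟨hx, h2⟩
          · left
            obtain ⟨d, rfl⟩ := Nat.exists_eq_add_of_le (not_le.mp hx).le
            have hd : k ∣ d := by
              have := (Nat.modEq_iff_dvd' (Nat.le_add_right m d)).mp h2.symm
              simpa using this
            have := Nat.le_of_dvd (by omega) hd
            omega
        · rintro (rfl | ⟨h1, h2⟩)
          · exact ⟨le_rfl, by simp⟩
          · exact ⟨by omega, h2⟩
      rw [hm, ih m (by omega)] at hstep
      rw [hstep, Nat.add_mod_right, step a, step b]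
      grind

/-- Finiteness of the positive part forces an odd number of flips in each residue class. -/
theorem residue_iff_of_three_flips {M : Set ℤ} (hM : IsCanonicalMaya M) {k : ℕ}
    (hk : 1 ≤ k) {a b : ℕ} (ha : 0 < a) (hab : a < b)
    (hcyc : symmDiff M (finsetFlips {0, a, b}) = mayaShift M (k : ℤ)) {r : ℕ} (hr : r < k) :
    r = 0 ↔ (a % k = r ↔ b % k = r) := by
  obtain ⟨B, hB⟩ := hM.2.2.bddAbove
  have hlarge : b + B.toNat + 1 ≤ (b + B.toNat + 1) * k := Nat.le_mul_of_pos_right _ hk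
  set n := r + (b + B.toNat + 1) * k with hn
  have hnM : (n : ℤ) ∉ M := fun h => by
    have := hB (show (n : ℤ) ∈ {n : ℤ | n ∈ M ∧ 0 ≤ n} from ⟨h, by omega⟩)
    omega
  have hmod : n % k = r := by rw [hn, Nat.add_mul_mod_self_right, Nat.mod_eq_of_lt hr]
  rw [mem_iff_of_three_flips hM.1 hk ha hab hcyc, hmod] at hnM
  have h1 : a ≤ n := by omega
  have h2 : b ≤ n := by omega
  tauto

theorem mem_kBlock_three {n r s : ℕ} (hr : r < 3) :
    n ∈ kBlock r s 3 ↔ n % 3 = r ∧ n < r + 3 * s := by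
  constructor
  · rintro ⟨i, hi, rfl⟩
    omega
  · rintro ⟨h1, h2⟩
    exact ⟨n / 3, by omega, by omega⟩

/-- classification of 3-cyclic Maya diagrams: if a canonical Maya
diagram `M` is sent to `M ⊕ k` (`k ≥ 1`) by the three flips of a set `F` with
`|F| = 3`, then exactly one of the following holds: (i) `k = 1`, the positive part of
`M` is a generalized Hermite block `{λ, …, λ+μ-1}` and `F = {0, λ, λ+μ}`; or
(ii) `k = 3`, the positive part of `M` is a 3-Okamoto Maya diagram
`{1+3i : i < α₁} ∪ {2+3i : i < α₂}` and `F = {0, 1+3α₁, 2+3α₂}`. -/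
theorem three_cyclic_maya_classification (M : Set ℤ) (hM : IsCanonicalMaya M)
    (k : ℕ) (hk : 1 ≤ k) (F : Finset ℕ) (hcard : F.card = 3)
    (hcyc : symmDiff M (finsetFlips F) = mayaShift M (k : ℤ)) :
    Xor'
      (k = 1 ∧ ∃ lam mu : ℕ, 1 ≤ lam ∧ 1 ≤ mu ∧
        mayaPos M = kBlock lam mu 1 ∧
        (↑F : Set ℕ) = {0, lam, lam + mu})
      (k = 3 ∧ ∃ a1 a2 : ℕ,
        mayaPos M = kBlock 1 a1 3 ∪ kBlock 2 a2 3 ∧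
        (↑F : Set ℕ) = {0, 1 + 3 * a1, 2 + 3 * a2}) := by
  have h0 : 0 ∈ F := by
    have h := mem_iff_of_symmDiff_eq_mayaShift hcyc 0
    have h1 : ((0 : ℕ) : ℤ) - k ∈ M := hM.1 _ (by omega)
    have h2 : ((0 : ℕ) : ℤ) ∉ M := by simpa using hM.2.1
    tauto
  obtain ⟨a, b, ha, hab, rfl⟩ := Finset.exists_eq_of_zero_mem_of_card_eq_three h0 hcard
  have hmem := mem_iff_of_three_flips hM.1 hk ha hab hcyc
  have hres : ∀ r < k, (r = 0 ↔ (a % k = r ↔ b % k = r)) := fun r hr =>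
    residue_iff_of_three_flips hM hk ha hab hcyc hr
  have hk13 : k = 1 ∨ k = 3 := by
    by_contra! hne
    have r0 := hres 0 (by omega)
    have r1 := hres 1 (by omega)
    rcases (show k = 2 ∨ 4 ≤ k by omega) with rfl | h4
    · omega
    · have r2 := hres 2 (by omega)
      have r3 := hres 3 (by omega)
      omega
  rcases hk13 with rfl | rfl
  · refine Or.inl ⟨⟨rfl, a, b - a, by omega, by omega, ?_, ?_⟩, by simp⟩
    · ext n
      have hblock : n ∈ kBlock a (b - a) 1 ↔ a ≤ n ∧ n < b := by
        constructor
        · rintro ⟨i, hi, rfl⟩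
          omega
        · rintro ⟨h1, h2⟩
          exact ⟨n - a, by omega, by omega⟩
      rw [hblock]
      refine (hmem n).trans ?_
      omega
    · simp [Nat.add_sub_of_le hab.le]
  · refine Or.inr ⟨⟨rfl, ?_⟩, by simp⟩
    have r0 := hres 0 (by omega)
    have r1 := hres 1 (by omega)
    have r2 := hres 2 (by omega)
    rcases (show (a % 3 = 1 ∧ b % 3 = 2) ∨ (a % 3 = 2 ∧ b % 3 = 1) by omega) with h | h
    · refine ⟨a / 3, b / 3, ?_, ?_⟩
      · ext n
        rw [Set.mem_union, mem_kBlock_three (by norm_num), mem_kBlock_three (by norm_num)]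
        refine (hmem n).trans ?_
        omega
      · rw [show 1 + 3 * (a / 3) = a by omega, show 2 + 3 * (b / 3) = b by omega]
        simp
    · refine ⟨b / 3, a / 3, ?_, ?_⟩
      · ext n
        rw [Set.mem_union, mem_kBlock_three (by norm_num), mem_kBlock_three (by norm_num)]
        refine (hmem n).trans ?_
        omega
      · rw [show 1 + 3 * (b / 3) = b by omega, show 2 + 3 * (a / 3) = a by omega,
          Set.pair_comm b a]
        simp
end

section
/- The isotonic oscillator is the unique 2-step cyclic potential: let Δ ≠ 0 and ε ∈ ℝ, and let w₁, w₂ : (0, ∞) → ℝ be differentiable functions satisfying the period-2 dressing chain −(w₂ + w₁)′ + w₂² − w₁² = ε and −(w₁ + w₂)′ + w₁² − w₂² = −ε − Δ together with the normalization w₁(x) + w₂(x) = Δx/2 for all x > 0. Then for all x > 0: w₁(x) = Δx/4 − (ε/Δ + 1/2)/x and w₂(x) = Δx/4 + (ε/Δ + 1/2)/x, and consequently w₁(x)² − w₁′(x) = ω²x²/4 + (α + 1/2)(α − 1/2)/x² − ω(α + 1), where ω = Δ/2 and α = ε/Δ; that is, the underlying potential is the isotonic oscillator with frequency ω and parameter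 α. -/
/-- the isotonic oscillator is the unique 2-step cyclic potential.
If `w₁, w₂` are differentiable on `(0, ∞)` and satisfy the period-2 dressing chain
`−(w₂ + w₁)′ + w₂² − w₁² = ε`, `−(w₁ + w₂)′ + w₁² − w₂² = −ε − Δ` with the
normalization `w₁ + w₂ = Δx/2` (`Δ ≠ 0`), then
`w₁(x) = Δx/4 − (ε/Δ + 1/2)/x`, `w₂(x) = Δx/4 + (ε/Δ + 1/2)/x`, and
`w₁² − w₁′ = ω²x²/4 + (α + 1/2)(α − 1/2)/x² − ω(α + 1)` with `ω = Δ/2`, `α = ε/Δ`: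
the underlying potential is the isotonic oscillator. -/
theorem two_step_cyclic_is_isotonic (Δ ε : ℝ) (hΔ : Δ ≠ 0) (w1 w2 : ℝ → ℝ)
    (hd1 : ∀ x : ℝ, 0 < x → DifferentiableAt ℝ w1 x)
    (hd2 : ∀ x : ℝ, 0 < x → DifferentiableAt ℝ w2 x)
    (hc1 : ∀ x : ℝ, 0 < x →
      -(deriv w2 x + deriv w1 x) + (w2 x) ^ 2 - (w1 x) ^ 2 = ε)
    (hc2 : ∀ x : ℝ, 0 < x →
      -(deriv w1 x + deriv w2 x) + (w1 x) ^ 2 - (w2 x) ^ 2 = -ε - Δ)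
    (hnorm : ∀ x : ℝ, 0 < x → w1 x + w2 x = Δ * x / 2) :
    ∀ x : ℝ, 0 < x →
      w1 x = Δ * x / 4 - (ε / Δ + 1 / 2) / x ∧
      w2 x = Δ * x / 4 + (ε / Δ + 1 / 2) / x ∧
      (w1 x) ^ 2 - deriv w1 x =
        (Δ / 2) ^ 2 * x ^ 2 / 4 + (ε / Δ + 1 / 2) * (ε / Δ - 1 / 2) / x ^ 2
          - (Δ / 2) * (ε / Δ + 1) := by
  have hw1 : ∀ x : ℝ, 0 < x → w1 x = Δ * x / 4 - (ε / Δ + 1 / 2) / x := by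
    intro x hx
    have hx' : x ≠ 0 := hx.ne'
    have hprod : (w2 x - w1 x) * (Δ * x / 2) = ε + Δ / 2 := by
      rw [← hnorm x hx]
      linear_combination (hc1 x hx - hc2 x hx) / 2
    have hdiff : w2 x - w1 x = 2 * ((ε / Δ + 1 / 2) / x) := by
      field_simp
      linear_combination 2 * hprod
    linear_combination (hnorm x hx - hdiff) / 2
  intro x hx
  have hx' : x ≠ 0 := hx.ne'
  have hderiv : HasDerivAt w1 (Δ / 4 + (ε / Δ + 1 / 2) / x ^ 2) x := by
    have h : HasDerivAt (fun y : ℝ => Δ / 4 * y - (ε / Δ + 1 / 2) * y⁻¹)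
        (Δ / 4 * 1 - (ε / Δ + 1 / 2) * -(x ^ 2)⁻¹) x :=
      ((hasDerivAt_id x).const_mul (Δ / 4)).sub ((hasDerivAt_inv hx').const_mul (ε / Δ + 1 / 2))
    refine (h.congr_of_eventuallyEq ?_).congr_deriv (by ring)
    filter_upwards [lt_mem_nhds hx] with y hy
    rw [hw1 y hy]
    ring
  refine ⟨hw1 x hx, by linear_combination hnorm x hx - hw1 x hx, ?_⟩
  rw [hderiv.deriv, hw1 x hx]
  field_simp
  ring
end

section
/- For every natural number m ≥ 0 and every t ∈ ℝ, the Wronskian of the generalized Laguerre polynomials L₀^{1/2}, L₁^{1/2}, …, L_m^{1/2} is the constant W(L₀^{1/2}, L₁^{1/2}, …, L_m^{1/2})(t) = (−1)^{m(m+1)/2}. -/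
/-- The generalized Laguerre polynomial
`L_n^α(x) = Σ_{k=0}^{n} (−1)^k · (∏_{i=k+1}^{n} (α+i)) / ((n−k)!·k!) · x^k`,
as a function on `ℝ`. -/
noncomputable def laguerreL (α : ℝ) (n : ℕ) : ℝ → ℝ := fun x =>
  ∑ k ∈ Finset.range (n + 1),
    (-1 : ℝ) ^ k * (∏ i ∈ Finset.Icc (k + 1) n, (α + (i : ℝ)))
      / (((n - k).factorial : ℝ) * (k.factorial : ℝ)) * x ^ k

theorem iteratedDeriv_laguerreL (α : ℝ) (n i : ℕ) (z : ℝ) :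
    iteratedDeriv i (laguerreL α n) z = ∑ k ∈ Finset.range (n + 1),
      (-1 : ℝ) ^ k * (∏ l ∈ Finset.Icc (k + 1) n, (α + (l : ℝ)))
        / (((n - k).factorial : ℝ) * (k.factorial : ℝ)) * (k.descFactorial i * z ^ (k - i)) := by
  unfold laguerreL
  rw [iteratedDeriv_fun_sum fun k _ => by fun_prop]
  refine Finset.sum_congr rfl fun k _ => ?_
  rw [iteratedDeriv_const_mul_field, iteratedDeriv_pow]

theorem iteratedDeriv_laguerreL_of_lt (α : ℝ) {n i : ℕ} (h : n < i) (z : ℝ) :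
    iteratedDeriv i (laguerreL α n) z = 0 := by
  rw [iteratedDeriv_laguerreL]
  refine Finset.sum_eq_zero fun k hk => ?_
  rw [Finset.mem_range] at hk
  simp [Nat.descFactorial_of_lt (show k < i by omega)]

theorem iteratedDeriv_laguerreL_self (α : ℝ) (n : ℕ) (z : ℝ) :
    iteratedDeriv n (laguerreL α n) z = (-1) ^ n := by
  have hn : (n.factorial : ℝ) ≠ 0 := by positivity
  rw [iteratedDeriv_laguerreL, Finset.sum_range_succ, Finset.sum_eq_zero, zero_add]
  · simp [Nat.descFactorial_self, hn]
  · intro k hk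
    simp [Nat.descFactorial_of_lt (Finset.mem_range.mp hk)]

/-- the Wronskian of the Laguerre polynomials
`L₀^{1/2}, L₁^{1/2}, …, L_m^{1/2}` is the constant `(−1)^{m(m+1)/2}`. -/
theorem laguerre_wronskian_constant (m : ℕ) (t : ℝ) :
    wronskian ((List.range (m + 1)).map (laguerreL (1/2))) t
      = (-1 : ℝ) ^ (m * (m + 1) / 2) := by
  unfold wronskian
  rw [Matrix.det_of_isUpperTriangular]
  · simp only [Matrix.of_apply, List.get_eq_getElem, List.getElem_map, List.getElem_range,
      iteratedDeriv_laguerreL_self]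
    rw [Finset.prod_pow_eq_pow_sum, Fin.sum_univ_eq_sum_range (fun i => i), List.length_map,
      List.length_range, Finset.sum_range_id, Nat.add_sub_cancel, mul_comm]
  · intro i j hij
    simpa using iteratedDeriv_laguerreL_of_lt (1 / 2) (Fin.lt_def.mp hij) t
end

section
/- For every integer m ≥ 1 there exists a nonzero real constant c such that the Wronskian of the odd-indexed Hermite polynomials satisfies W(H₁, H₃, …, H_{2m−1})(z) = c · z^{m(m+1)/2} for all z ∈ ℝ. -/
open Polynomial Matrix in
/-- The iterated derivatives at `z` of an odd polynomial, in terms of its coefficients. -/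
theorem eval_iterate_derivative_X_mul_expand_two {g : ℝ[X]} {m : ℕ} (hg : g.natDegree < m)
    (i : ℕ) (z : ℝ) :
    (derivative^[i] (X * expand ℝ 2 g)).eval z =
      ∑ k : Fin m, ((2 * k.val + 1).descFactorial i : ℝ) * z ^ (2 * k.val + 1 - i) *
        g.coeff k := by
  have hexp : X * expand ℝ 2 g = ∑ k ∈ Finset.range m, C (g.coeff k) * X ^ (2 * k + 1) := by
    conv_lhs => rw [g.as_sum_range_C_mul_X_pow' hg]
    simp only [map_sum, map_mul, expand_C, map_pow, expand_X, Finset.mul_sum]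
    exact Finset.sum_congr rfl fun k _ => by ring
  rw [hexp, iterate_derivative_sum, eval_finsetSum, Finset.sum_range]
  refine Finset.sum_congr rfl fun k _ => ?_
  simp only [iterate_derivative_C_mul, iterate_derivative_X_pow_eq_C_mul, eval_mul, eval_C,
    eval_pow, eval_X]
  ring

open Polynomial in
theorem iteratedDeriv_polynomial_eval (p : ℝ[X]) (i : ℕ) :
    iteratedDeriv i (fun x => p.eval x) = fun x => (derivative^[i] p).eval x := by
  induction i with
  | zero => simp
  | succ i ih =>
    ext x
    rw [iteratedDeriv_succ, ih, Polynomial.deriv, Function.iterate_succ_apply']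

theorem det_descFactorial_ne_zero {m : ℕ} {v : Fin m → ℕ} (hv : Function.Injective v) :
    (Matrix.of fun i k : Fin m => ((v k).descFactorial i.val : ℝ)).det ≠ 0 := by
  have h := Matrix.det_eval_matrixOfPolynomials_eq_det_vandermonde (fun k => (v k : ℝ))
    (fun i => descPochhammer ℝ i) (fun i => descPochhammer_natDegree ℝ i)
    (fun i => monic_descPochhammer ℝ i)
  rw [← Matrix.det_transpose]
  have h' : (Matrix.of fun i k : Fin m => ((v k).descFactorial i.val : ℝ)).transpose =
      Matrix.of fun k i : Fin m => (descPochhammer ℝ i.val).eval (v k : ℝ) := by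
    ext k i
    simp [descPochhammer_eval_eq_descFactorial]
  rw [h', ← h, Matrix.det_vandermonde_ne_zero_iff]
  exact Nat.cast_injective.comp hv

/-- The Wronskian of the first `m` odd monomials. -/
theorem det_derivatives_odd_monomials {m : ℕ} (hm : 1 ≤ m) (z : ℝ) :
    (Matrix.of fun i k : Fin m =>
        ((2 * k.val + 1).descFactorial i.val : ℝ) * z ^ (2 * k.val + 1 - i.val)).det =
      (Matrix.of fun i k : Fin m => ((2 * k.val + 1).descFactorial i.val : ℝ)).det *
        z ^ (m * (m + 1) / 2) := by
  rcases eq_or_ne z 0 with rfl | hz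
  · have hpos : m * (m + 1) / 2 ≠ 0 := by
      have : 1 * 2 ≤ m * (m + 1) := Nat.mul_le_mul hm (by omega)
      omega
    rw [zero_pow hpos, mul_zero]
    exact Matrix.det_eq_zero_of_row_eq_zero ⟨0, hm⟩ fun k => by simp
  · set N := Matrix.of fun i k : Fin m => ((2 * k.val + 1).descFactorial i.val : ℝ) with hN
    set M := Matrix.of fun i k : Fin m =>
      ((2 * k.val + 1).descFactorial i.val : ℝ) * z ^ (2 * k.val + 1 - i.val) with hM
    have hrow := Matrix.det_mul_column (fun i : Fin m => z ^ i.val) M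
    have hcol := Matrix.det_mul_row (fun k : Fin m => z ^ (2 * k.val + 1)) N
    have hmat : (Matrix.of fun i k : Fin m => z ^ i.val * M i k) =
        Matrix.of fun i k : Fin m => z ^ (2 * k.val + 1) * N i k := by
      ext i k
      simp only [hM, hN, Matrix.of_apply]
      rcases le_or_gt i.val (2 * k.val + 1) with h | h
      · rw [mul_left_comm, ← pow_add, Nat.add_sub_cancel' h, mul_comm]
      · simp [Nat.descFactorial_of_lt h]
    rw [hmat, hcol, Finset.prod_pow_eq_pow_sum, Finset.prod_pow_eq_pow_sum,
      Fin.sum_univ_eq_sum_range (fun k => 2 * k + 1), Fin.sum_univ_eq_sum_range (fun k => k)]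
      at hrow
    have hexp : ∑ k ∈ Finset.range m, (2 * k + 1) =
        ∑ k ∈ Finset.range m, k + m * (m + 1) / 2 := by
      have h1 := Finset.sum_range_id_mul_two (m + 1)
      rw [Finset.sum_range_succ] at h1
      rw [Finset.sum_add_distrib, ← Finset.mul_sum, Finset.sum_const, Finset.card_range,
        smul_eq_mul, mul_one]
      rw [Nat.add_sub_cancel, mul_comm (m + 1) m] at h1
      omega
    rw [hexp, pow_add, mul_assoc] at hrow
    rw [← mul_left_cancel₀ (pow_ne_zero _ hz) hrow, mul_comm]

open Polynomial in
/-- `H_{2j}` is a polynomial of degree `j` in `X²`, and `H_{2j+1}` is `X` times such a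
polynomial. -/
theorem exists_hermiteH_eq_expand_two (j : ℕ) :
    (∃ h : ℝ[X], hermiteH (2 * j) = expand ℝ 2 h ∧ h.natDegree ≤ j ∧ h.coeff j ≠ 0) ∧
      ∃ g : ℝ[X], hermiteH (2 * j + 1) = X * expand ℝ 2 g ∧ g.natDegree ≤ j ∧
        g.coeff j ≠ 0 := by
  induction j with
  | zero =>
    exact ⟨⟨1, by simp [hermiteH], by simp, by simp⟩,
      ⟨C 2, by rw [mul_zero, zero_add, hermiteH, expand_C, mul_comm], by simp, by simp⟩⟩
  | succ j ih =>
    obtain ⟨⟨h, hh, hdeg, hlead⟩, g, hg, gdeg, glead⟩ := ih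
    have even : ∃ h' : ℝ[X], hermiteH (2 * (j + 1)) = expand ℝ 2 h' ∧ h'.natDegree ≤ j + 1 ∧
        h'.coeff (j + 1) ≠ 0 := by
      refine ⟨C 2 * (X * g) - C (2 * (((2 * j : ℕ) : ℝ) + 1)) * h, ?_, ?_, ?_⟩
      · rw [show 2 * (j + 1) = 2 * j + 2 by ring, hermiteH, hg, hh]
        simp only [map_sub, map_mul, expand_C, expand_X]
        ring
      · refine (natDegree_sub_le _ _).trans (max_le ?_ ?_)
        · exact (natDegree_C_mul_le _ _).trans (natDegree_mul_le.trans
            (by rw [natDegree_X]; omega))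
        · exact (natDegree_C_mul_le _ _).trans (by omega)
      · rw [coeff_sub, coeff_C_mul, coeff_C_mul, coeff_X_mul,
          coeff_eq_zero_of_natDegree_lt (by omega : h.natDegree < j + 1)]
        simpa using glead
    refine ⟨even, ?_⟩
    obtain ⟨h', hh', hdeg', hlead'⟩ := even
    refine ⟨C 2 * h' - C (2 * (((2 * j + 1 : ℕ) : ℝ) + 1)) * g, ?_, ?_, ?_⟩
    · rw [show 2 * (j + 1) + 1 = (2 * j + 1) + 2 by ring, hermiteH,
        show 2 * j + 1 + 1 = 2 * (j + 1) by ring, hg, hh']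
      simp only [map_sub, map_mul, expand_C]
      ring
    · refine (natDegree_sub_le _ _).trans (max_le ?_ ?_)
      · exact (natDegree_C_mul_le _ _).trans hdeg'
      · exact (natDegree_C_mul_le _ _).trans (by omega)
    · rw [coeff_sub, coeff_C_mul, coeff_C_mul,
        coeff_eq_zero_of_natDegree_lt (by omega : g.natDegree < j + 1)]
      simpa using hlead'

theorem wronskian_map_range (f : ℕ → ℝ → ℝ) (m : ℕ) (z : ℝ) :
    wronskian ((List.range m).map f) z =
      (Matrix.of fun i j : Fin m => iteratedDeriv i.val (f j) z).det := by
  have hlen : ((List.range m).map f).length = m := by simp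
  rw [wronskian, ← Matrix.det_submatrix_equiv_self (finCongr hlen)]
  congr 1
  ext i j
  simp

/-- for every `m ≥ 1` there is a nonzero constant `c` with
`W(H₁, H₃, …, H_{2m−1})(z) = c · z^{m(m+1)/2}` for all real `z`. -/
theorem odd_hermite_wronskian_monomial (m : ℕ) (hm : 1 ≤ m) :
    ∃ c : ℝ, c ≠ 0 ∧ ∀ z : ℝ,
      wronskian ((List.range m).map fun i => fun x => (hermiteH (2 * i + 1)).eval x) z
        = c * z ^ (m * (m + 1) / 2) := by
  choose g hg gdeg glead using fun j => (exists_hermiteH_eq_expand_two j).2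
  set A : Matrix (Fin m) (Fin m) ℝ := Matrix.of fun k j => (g j).coeff k with hA
  have hAdet : A.det ≠ 0 := by
    have htri : A.BlockTriangular id := fun k j hjk =>
      Polynomial.coeff_eq_zero_of_natDegree_lt ((gdeg j).trans_lt hjk)
    rw [Matrix.det_of_isUpperTriangular htri]
    exact Finset.prod_ne_zero_iff.mpr fun j _ => glead j
  refine ⟨_, mul_ne_zero (det_descFactorial_ne_zero (m := m) (v := fun k => 2 * k.val + 1)
    fun a b hab => Fin.ext (by simpa using hab)) hAdet, fun z => ?_⟩
  rw [wronskian_map_range, mul_right_comm, ← det_derivatives_odd_monomials hm, ← Matrix.det_mul]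
  congr 1
  ext i j
  simp only [Matrix.of_apply, Matrix.mul_apply, hA, iteratedDeriv_polynomial_eval, hg]
  exact eval_iterate_derivative_X_mul_expand_two ((gdeg j).trans_lt j.isLt) i z
end
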